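/- For all integers m ≥ 1 and k ≥ 1, the homomorphism η'_{2k−1} : 𝒯_{2k−1} → D'_{2k−1} maps the image of Δ_{2k−1} into the image of the homomorphism ℤ₂ ⊗ D'_{k−1} → D'_{2k−1} induced by X ⊗ Y ↦ X ⊗ [Y,Y], and the induced homomorphism η̃_{2k−1} : 𝒯̃_{2k−1} → D̃_{2k−1} is an isomorphism. -/

import Mathlib

open scoped TensorProduct

/-- Rooted binary trees (formal non-associative bracket monomials) with
leaves labeled in `Fin m`.  The degree is the number of leaves, the order is
the degree minus one. -/
inductive RTree (m : ℕ) : Type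
  | leaf : Fin m → RTree m
  | node : RTree m → RTree m → RTree m

namespace RTree

/-- The degree of a rooted tree = its number of leaves. -/
def deg {m : ℕ} : RTree m → ℕ
  | leaf _ => 1
  | node a b => deg a + deg b

end RTree

/-- One-hole contexts for rooted trees. -/
inductive Ctx (m : ℕ) : Type
  | hole : Ctx m
  | nodeL : Ctx m → RTree m → Ctx m
  | nodeR : RTree m → Ctx m → Ctx m

/-- Fill the hole of a context with a rooted tree. -/
def Ctx.fill {m : ℕ} : Ctx m → RTree m → RTree m
  | .hole, t => t
  | .nodeL c r, t => RTree.node (c.fill t) r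
  | .nodeR l c, t => RTree.node l (c.fill t)

/-- Relators presenting the degree `n` part `L'_n` of the free quasi-Lie ring:
generators of the wrong degree are killed, and antisymmetry and Jacobi
relators are imposed at every position (one-hole context). -/
def quasiLieRels (m n : ℕ) : Set (FreeAbelianGroup (RTree m)) :=
  {x | ∃ J : RTree m, J.deg ≠ n ∧ x = FreeAbelianGroup.of J} ∪
  {x | ∃ (c : Ctx m) (A B : RTree m),
      x = FreeAbelianGroup.of (c.fill (RTree.node A B)) +
          FreeAbelianGroup.of (c.fill (RTree.node B A))} ∪
  {x | ∃ (c : Ctx m) (A B C : RTree m),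
      x = FreeAbelianGroup.of (c.fill (RTree.node A (RTree.node B C))) -
          FreeAbelianGroup.of (c.fill (RTree.node (RTree.node A B) C)) -
          FreeAbelianGroup.of (c.fill (RTree.node B (RTree.node A C)))}

/-- `L'_n`, the degree `n` part of Levine's free quasi-Lie ring on `X_1,…,X_m`. -/
abbrev Lp (m n : ℕ) :=
  FreeAbelianGroup (RTree m) ⧸ AddSubgroup.closure (quasiLieRels m n)

/-- The canonical projection onto `L'_n`. -/
abbrev LpMk (m n : ℕ) : FreeAbelianGroup (RTree m) →+ Lp m n :=
  QuotientAddGroup.mk' _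

/-- Relators for the free Lie ring: additionally kill all squares `[J,J]`
(at every position). -/
def lieRels (m n : ℕ) : Set (FreeAbelianGroup (RTree m)) :=
  quasiLieRels m n ∪
  {x | ∃ (c : Ctx m) (J : RTree m), x = FreeAbelianGroup.of (c.fill (RTree.node J J))}

/-- `L_n`, the degree `n` part of the free Lie ring on `X_1,…,X_m` over `ℤ`. -/
abbrev LL (m n : ℕ) :=
  FreeAbelianGroup (RTree m) ⧸ AddSubgroup.closure (lieRels m n)

/-- The canonical projection onto `L_n`. -/
abbrev LLMk (m n : ℕ) : FreeAbelianGroup (RTree m) →+ LL m n :=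
  QuotientAddGroup.mk' _

/-- The canonical projection `L'_n → L_n`. -/
def LpToLL (m n : ℕ) : Lp m n →+ LL m n :=
  QuotientAddGroup.map _ _ (AddMonoidHom.id _)
    (by
      rw [AddSubgroup.comap_id]
      exact AddSubgroup.closure_mono Set.subset_union_left)

/-- Free-level bracketing `t ↦ [X i, t]` with a degree one generator. -/
def brLeafFree (m : ℕ) (i : Fin m) :
    FreeAbelianGroup (RTree m) →+ FreeAbelianGroup (RTree m) :=
  FreeAbelianGroup.lift fun t => FreeAbelianGroup.of (RTree.node (RTree.leaf i) t)

theorem brLeafFree_mem_quasi {m n : ℕ} (i : Fin m) {x : FreeAbelianGroup (RTree m)}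
    (hx : x ∈ quasiLieRels m n) :
    brLeafFree m i x ∈ AddSubgroup.closure (quasiLieRels m (n + 1)) := by
  apply AddSubgroup.subset_closure
  rcases hx with (⟨J, hJ, rfl⟩ | ⟨c, A, B, rfl⟩) | ⟨c, A, B, C, rfl⟩
  · refine Or.inl (Or.inl ⟨RTree.node (RTree.leaf i) J, ?_, ?_⟩)
    · simp only [RTree.deg]; omega
    · simp [brLeafFree]
  · refine Or.inl (Or.inr ⟨Ctx.nodeR (RTree.leaf i) c, A, B, ?_⟩)
    simp [brLeafFree, Ctx.fill]
  · refine Or.inr ⟨Ctx.nodeR (RTree.leaf i) c, A, B, C, ?_⟩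
    simp [brLeafFree, Ctx.fill]

theorem brLeafFree_closure_quasi {m n : ℕ} (i : Fin m) :
    AddSubgroup.closure (quasiLieRels m n) ≤
      (AddSubgroup.closure (quasiLieRels m (n + 1))).comap (brLeafFree m i) :=
  (AddSubgroup.closure_le _).2 fun _x hx =>
    AddSubgroup.mem_comap.2 (brLeafFree_mem_quasi i hx)

/-- Bracketing `[X_i, ·] : L'_n → L'_{n+1}` with a degree one generator. -/
def brLeaf (m n : ℕ) (i : Fin m) : Lp m n →+ Lp m (n + 1) :=
  QuotientAddGroup.map _ _ (brLeafFree m i) (brLeafFree_closure_quasi i)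

theorem brLeafFree_mem_lie {m n : ℕ} (i : Fin m) {x : FreeAbelianGroup (RTree m)}
    (hx : x ∈ lieRels m n) :
    brLeafFree m i x ∈ AddSubgroup.closure (lieRels m (n + 1)) := by
  apply AddSubgroup.subset_closure
  rcases hx with ((⟨J, hJ, rfl⟩ | ⟨c, A, B, rfl⟩) | ⟨c, A, B, C, rfl⟩) | ⟨c, J, rfl⟩
  · refine Or.inl (Or.inl (Or.inl ⟨RTree.node (RTree.leaf i) J, ?_, ?_⟩))
    · simp only [RTree.deg]; omega
    · simp [brLeafFree]
  · exact Or.inl (Or.inl (Or.inr ⟨Ctx.nodeR (RTree.leaf i) c, A, B, by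
      simp [brLeafFree, Ctx.fill]⟩))
  · exact Or.inl (Or.inr ⟨Ctx.nodeR (RTree.leaf i) c, A, B, C, by
      simp [brLeafFree, Ctx.fill]⟩)
  · exact Or.inr ⟨Ctx.nodeR (RTree.leaf i) c, J, by simp [brLeafFree, Ctx.fill]⟩

theorem brLeafFree_closure_lie {m n : ℕ} (i : Fin m) :
    AddSubgroup.closure (lieRels m n) ≤
      (AddSubgroup.closure (lieRels m (n + 1))).comap (brLeafFree m i) :=
  (AddSubgroup.closure_le _).2 fun _x hx =>
    AddSubgroup.mem_comap.2 (brLeafFree_mem_lie i hx)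

/-- Bracketing `[X_i, ·] : L_n → L_{n+1}` with a degree one generator. -/
def brLeafL (m n : ℕ) (i : Fin m) : LL m n →+ LL m (n + 1) :=
  QuotientAddGroup.map _ _ (brLeafFree m i) (brLeafFree_closure_lie i)

/-- The bracket map `L'_1 ⊗ L'_a → L'_{a+1}`, `X_i ⊗ Y ↦ [X_i, Y]`,
where `L'_1 = L_1 ≅ ℤ^m` is realized as `FreeAbelianGroup (Fin m)` with basis `X_i`.
The kernel of `bracketLp m (n+1)` is the group `D'_n`. -/
noncomputable def bracketLp (m a : ℕ) :
    (FreeAbelianGroup (Fin m)) ⊗[ℤ] (Lp m a) →ₗ[ℤ] Lp m (a + 1) :=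
  TensorProduct.lift
    ((FreeAbelianGroup.lift fun i => (brLeaf m a i).toIntLinearMap).toIntLinearMap)

/-- The bracket map `L_1 ⊗ L_a → L_{a+1}`.  The kernel of `bracketLL m (n+1)` is `D_n`. -/
noncomputable def bracketLL (m a : ℕ) :
    (FreeAbelianGroup (Fin m)) ⊗[ℤ] (LL m a) →ₗ[ℤ] LL m (a + 1) :=
  TensorProduct.lift
    ((FreeAbelianGroup.lift fun i => (brLeafL m a i).toIntLinearMap).toIntLinearMap)

/-- `id ⊗ proj : L_1 ⊗ L'_n → L_1 ⊗ L_n`. -/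
noncomputable def projT (m n : ℕ) :
    (FreeAbelianGroup (Fin m)) ⊗[ℤ] (Lp m n) →ₗ[ℤ]
      (FreeAbelianGroup (Fin m)) ⊗[ℤ] (LL m n) :=
  LinearMap.lTensor _ (LpToLL m n).toIntLinearMap

/-- Given a rooted tree `t` and a rooted tree `rest` (representing the rest of the
unrooted tree `⟨t, rest⟩` hanging off the root edge of `t`), list, for each leaf `v`
of `t`, the label of `v` together with the rooted tree obtained from the unrooted
tree `⟨t, rest⟩` by making `v` the root. -/
def rerootList {m : ℕ} : RTree m → RTree m → List (Fin m × RTree m)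
  | RTree.leaf i, rest => [(i, rest)]
  | RTree.node a b, rest =>
      rerootList a (RTree.node b rest) ++ rerootList b (RTree.node rest a)

/-- All univalent vertices of the unrooted tree `⟨p.1, p.2⟩`, together with the
corresponding rerooted trees. -/
def pairReroots {m : ℕ} (p : RTree m × RTree m) : List (Fin m × RTree m) :=
  rerootList p.1 p.2 ++ rerootList p.2 p.1

/-- Relators presenting the order `n` tree group `𝒯_n`.  An unrooted unitrivalent
labeled vertex-oriented tree is presented as the inner product `⟨I,J⟩` of a pair of
rooted trees (cutting an edge); generators of the wrong order are killed, and we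
impose: symmetry `⟨I,J⟩ = ⟨J,I⟩`, edge-sliding `⟨(A,B),C⟩ = ⟨A,(B,C)⟩` (both of
which express that the pair presents the same unrooted tree), antisymmetry (AS),
and Jacobi (IHX) relations. -/
def treeRels (m n : ℕ) : Set (FreeAbelianGroup (RTree m × RTree m)) :=
  {x | ∃ p : RTree m × RTree m, p.1.deg + p.2.deg ≠ n + 2 ∧ x = FreeAbelianGroup.of p} ∪
  {x | ∃ I J : RTree m, x = FreeAbelianGroup.of (I, J) - FreeAbelianGroup.of (J, I)} ∪
  {x | ∃ A B C : RTree m,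
      x = FreeAbelianGroup.of (RTree.node A B, C) - FreeAbelianGroup.of (A, RTree.node B C)} ∪
  {x | ∃ A B C : RTree m,
      x = FreeAbelianGroup.of (RTree.node A B, C) + FreeAbelianGroup.of (RTree.node B A, C)} ∪
  {x | ∃ A B C D : RTree m,
      x = FreeAbelianGroup.of (RTree.node A (RTree.node B C), D)
        - FreeAbelianGroup.of (RTree.node (RTree.node A B) C, D)
        - FreeAbelianGroup.of (RTree.node B (RTree.node A C), D)}

/-- `𝒯_n`, the order `n` tree group. -/
abbrev Tgrp (m n : ℕ) :=
  FreeAbelianGroup (RTree m × RTree m) ⧸ AddSubgroup.closure (treeRels m n)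

/-- The canonical projection onto `𝒯_n`; the generator `⟨I,J⟩` is `TMk m n (.of (I,J))`. -/
abbrev TMk (m n : ℕ) : FreeAbelianGroup (RTree m × RTree m) →+ Tgrp m n :=
  QuotientAddGroup.mk' _

/-- The boundary-twist relators `⟨(i,J),J⟩` (for `J` of order `k-1`, i.e. degree `k`). -/
def btRels (m k : ℕ) : Set (FreeAbelianGroup (RTree m × RTree m)) :=
  {x | ∃ (i : Fin m) (J : RTree m), J.deg = k ∧
      x = FreeAbelianGroup.of (RTree.node (RTree.leaf i) J, J)}

/-- `𝒯^∞_{2k-1}`, the quotient of `𝒯_{2k-1}` by the boundary-twist relations. -/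
abbrev Tinfodd (m k : ℕ) :=
  FreeAbelianGroup (RTree m × RTree m) ⧸
    AddSubgroup.closure (treeRels m (2 * k - 1) ∪ btRels m k)

abbrev TinfoddMk (m k : ℕ) : FreeAbelianGroup (RTree m × RTree m) →+ Tinfodd m k :=
  QuotientAddGroup.mk' _

/-- Relators presenting `𝒯^∞_{2k}`: generators are order `2k` unrooted trees
(`Sum.inl` of a pair of rooted trees, as in `treeRels`) together with `∞`-trees
`J^∞` (`Sum.inr J`) for rooted trees `J` of order `k` (degree `k+1`).  Relations:
the relations of `𝒯_{2k}` among the non-`∞` trees, wrong-degree `∞`-generators are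
killed, the symmetry relations `(-J)^∞ = J^∞`, the twisted IHX relations
`I^∞ = H^∞ + X^∞ - ⟨H,X⟩`, and the interior-twist relations `2 J^∞ = ⟨J,J⟩`. -/
def tinfRels (m k : ℕ) : Set (FreeAbelianGroup ((RTree m × RTree m) ⊕ RTree m)) :=
  (⇑(FreeAbelianGroup.map (Sum.inl : RTree m × RTree m → (RTree m × RTree m) ⊕ RTree m)) ''
      treeRels m (2 * k)) ∪
  {x | ∃ J : RTree m, J.deg ≠ k + 1 ∧ x = FreeAbelianGroup.of (Sum.inr J)} ∪
  {x | ∃ (c : Ctx m) (A B : RTree m),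
      x = FreeAbelianGroup.of (Sum.inr (c.fill (RTree.node A B)))
        - FreeAbelianGroup.of (Sum.inr (c.fill (RTree.node B A)))} ∪
  {x | ∃ (c : Ctx m) (A B C : RTree m),
      x = FreeAbelianGroup.of (Sum.inr (c.fill (RTree.node A (RTree.node B C))))
        - FreeAbelianGroup.of (Sum.inr (c.fill (RTree.node (RTree.node A B) C)))
        - FreeAbelianGroup.of (Sum.inr (c.fill (RTree.node B (RTree.node A C))))
        + FreeAbelianGroup.of (Sum.inl (c.fill (RTree.node (RTree.node A B) C),
            c.fill (RTree.node B (RTree.node A C))))} ∪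
  {x | ∃ J : RTree m,
      x = FreeAbelianGroup.of (Sum.inr J) + FreeAbelianGroup.of (Sum.inr J)
        - FreeAbelianGroup.of (Sum.inl (J, J))}

/-- `𝒯^∞_{2k}`, the twisted tree group in even order `2k`. -/
abbrev Tinf (m k : ℕ) :=
  FreeAbelianGroup ((RTree m × RTree m) ⊕ RTree m) ⧸ AddSubgroup.closure (tinfRels m k)

abbrev TinfMk (m k : ℕ) :
    FreeAbelianGroup ((RTree m × RTree m) ⊕ RTree m) →+ Tinf m k :=
  QuotientAddGroup.mk' _

/-- The degree-guarded free-level bracket: for `s, t` rooted trees,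
`brFree m a b (of s) (of t) = of [s,t]` if `s` has degree `a` and `t` degree `b`,
and `0` otherwise.  It induces the bracket `L'_a × L'_b → L'_{a+b}`. -/
def brFree (m a b : ℕ) :
    FreeAbelianGroup (RTree m) →+
      FreeAbelianGroup (RTree m) →+ FreeAbelianGroup (RTree m) :=
  FreeAbelianGroup.lift fun s =>
    FreeAbelianGroup.lift fun t =>
      if s.deg = a ∧ t.deg = b then FreeAbelianGroup.of (RTree.node s t) else 0

/-- Binary trees with leaves labelled by `W`. -/
inductive BTree (W : Type) : Type
  | leaf : W → BTree W
  | node : BTree W → BTree W → BTree W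

namespace BTree

/-- The multiset of leaf labels of a binary tree. -/
def letters {W : Type} : BTree W → Multiset W
  | leaf w => {w}
  | node a b => letters a + letters b

theorem letters_card_pos {W : Type} (t : BTree W) : 0 < t.letters.card := by
  induction t with
  | leaf w => simp [letters]
  | node a b iha _ => simp [letters]; omega

/-- Evaluation of a binary tree as an iterated bracket in a Lie ring. -/
def eval {W G : Type} [LieRing G] (f : W → G) : BTree W → G
  | leaf w => f w
  | node a b => ⁅eval f a, eval f b⁆

end BTree

/-- The Lie bracket as a biadditive map. -/
def lieBiadd (G : Type) [LieRing G] : G →+ G →+ G :=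
  AddMonoidHom.mk' (fun a => AddMonoidHom.mk' (fun b => ⁅a, b⁆) (lie_add a)) fun a b => by
    ext c; simp

@[simp] theorem lieBiadd_apply {G : Type} [LieRing G] (a b : G) : lieBiadd G a b = ⁅a, b⁆ := rfl

open BTree in
/-- Relators of the free Lie ring on `W`. -/
inductive LieRelator {W : Type} : FreeAbelianGroup (BTree W) → Prop
  | sq (A : BTree W) : LieRelator (.of (node A A))
  | anti (A B : BTree W) : LieRelator (.of (node A B) + .of (node B A))
  | jac (A B C : BTree W) : LieRelator
      (.of (node A (node B C)) - .of (node (node A B) C) - .of (node B (node A C)))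
  | left (A : BTree W) {x : FreeAbelianGroup (BTree W)} :
      LieRelator x → LieRelator (FreeAbelianGroup.map (node A) x)

/-- The free Lie ring on `W`. -/
def FreeLie (W : Type) : Type :=
  FreeAbelianGroup (BTree W) ⧸ AddSubgroup.closure {x | LieRelator (W := W) x}

namespace FreeLie

variable {W : Type}

instance : AddCommGroup (FreeLie W) :=
  inferInstanceAs (AddCommGroup (FreeAbelianGroup (BTree W) ⧸ AddSubgroup.closure _))

/-- The projection from formal sums of trees. -/
def proj : FreeAbelianGroup (BTree W) →+ FreeLie W := QuotientAddGroup.mk' _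

/-- The class of a tree. -/
def mk (t : BTree W) : FreeLie W := proj (.of t)

theorem proj_of (t : BTree W) : proj (.of t) = mk t := rfl

theorem proj_surjective : Function.Surjective (proj (W := W)) :=
  QuotientAddGroup.mk'_surjective _

theorem proj_relator {x : FreeAbelianGroup (BTree W)} (h : LieRelator x) : proj x = 0 :=
  (QuotientAddGroup.eq_zero_iff x).2 (AddSubgroup.subset_closure h)

/-- Additive maps out of the free Lie ring. -/
def desc {A : Type} [AddCommGroup A] (f : FreeAbelianGroup (BTree W) →+ A)
    (h : ∀ x, LieRelator x → f x = 0) : FreeLie W →+ A :=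
  QuotientAddGroup.lift _ f ((AddSubgroup.closure_le _).2 h)

theorem desc_mk {A : Type} [AddCommGroup A] (f : FreeAbelianGroup (BTree W) →+ A)
    (h : ∀ x, LieRelator x → f x = 0) (t) : desc f h (mk t) = f (.of t) := rfl

theorem hom_ext {A : Type} [AddCommGroup A] {f g : FreeLie W →+ A}
    (h : ∀ t, f (mk t) = g (mk t)) : f = g := by
  have : f.comp proj = g.comp proj := FreeAbelianGroup.lift_ext _ _ h
  ext x
  obtain ⟨x, rfl⟩ := proj_surjective x
  exact DFunLike.congr_fun this x

theorem induction_on {p : FreeLie W → Prop} (x : FreeLie W) (hmk : ∀ t, p (mk t))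
    (h0 : p 0) (hneg : ∀ x, p x → p (-x)) (hadd : ∀ x y, p x → p y → p (x + y)) : p x := by
  obtain ⟨x, rfl⟩ := proj_surjective x
  induction x using FreeAbelianGroup.induction_on with
  | zero => simpa using h0
  | of t => exact hmk t
  | neg t ih => rw [map_neg]; exact hneg _ ih
  | add x y hx hy => rw [map_add]; exact hadd _ _ hx hy

/-- Left bracketing with a tree. -/
def brTree (A : BTree W) : FreeLie W →+ FreeLie W :=
  desc (proj.comp (FreeAbelianGroup.map (BTree.node A))) fun _ hx => proj_relator (hx.left A)

theorem brTree_mk (A B : BTree W) : brTree A (mk B) = mk (.node A B) := by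
  rw [brTree, desc_mk, AddMonoidHom.comp_apply, FreeAbelianGroup.map_of_apply, proj_of]

theorem mk_anti (A B : BTree W) : mk (.node A B) = - mk (.node B A) := by
  rw [eq_neg_iff_add_eq_zero]
  simpa only [map_add, proj_of] using proj_relator (LieRelator.anti A B)

/-- The bracket as a biadditive map. -/
def bracketHom : FreeLie W →+ FreeLie W →+ FreeLie W :=
  desc (FreeAbelianGroup.lift brTree) fun x hx => by
    have key : ∀ (B : BTree W) (x : FreeAbelianGroup (BTree W)),
        FreeAbelianGroup.lift brTree x (mk B) = - brTree B (proj x) := by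
      intro B x
      induction x using FreeAbelianGroup.induction_on with
      | zero => simp
      | of t => simp [proj_of, brTree_mk, mk_anti t B]
      | neg t ih => simp only [map_neg, AddMonoidHom.neg_apply, ih]
      | add x y hx hy => simp [hx, hy]; abel
    exact hom_ext fun B => by rw [key, proj_relator hx]; simp

instance : Bracket (FreeLie W) (FreeLie W) := ⟨fun a b => bracketHom a b⟩

theorem bracketHom_apply (a b : FreeLie W) : bracketHom a b = ⁅a, b⁆ := rfl

theorem mk_node (A B : BTree W) : mk (.node A B) = ⁅mk A, mk B⁆ := by
  rw [← bracketHom_apply, bracketHom, desc_mk, FreeAbelianGroup.lift_apply_of, brTree_mk]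

theorem bracketHom_skew (a b : FreeLie W) : bracketHom a b = - bracketHom b a := by
  have : (bracketHom : FreeLie W →+ _) = -bracketHom.flip :=
    hom_ext fun s => hom_ext fun t => by
      simp [bracketHom_apply, ← mk_node, mk_anti s t]
  exact DFunLike.congr_fun (DFunLike.congr_fun this a) b

theorem bracketHom_self (a : FreeLie W) : bracketHom a a = 0 := by
  induction a using induction_on with
  | hmk t => rw [bracketHom_apply, ← mk_node]; exact proj_relator (.sq t)
  | h0 => simp
  | hneg x h => simp [h]
  | hadd x y hx hy => simp [hx, hy, bracketHom_skew x y]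

theorem bracketHom_jac (a b c : FreeLie W) : bracketHom a (bracketHom b c) =
    bracketHom (bracketHom a b) c + bracketHom b (bracketHom a c) := by
  induction a using induction_on with
  | hmk s =>
    induction b using induction_on with
    | hmk t =>
      induction c using induction_on with
      | hmk u =>
        have := proj_relator (LieRelator.jac s t u)
        simp only [map_sub, proj_of] at this
        simp only [bracketHom_apply, ← mk_node]
        rw [sub_sub, sub_eq_zero] at this
        exact this
      | h0 => simp
      | hneg x h => simp only [map_neg, h]; abel
      | hadd x y hx hy => simp only [map_add, hx, hy]; abel
    | h0 => simp
    | hneg x h => simp only [map_neg, AddMonoidHom.neg_apply, h]; abel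
    | hadd x y hx hy => simp only [map_add, AddMonoidHom.add_apply, hx, hy]; abel
  | h0 => simp
  | hneg x h => simp only [map_neg, AddMonoidHom.neg_apply, h]; abel
  | hadd x y hx hy => simp only [map_add, AddMonoidHom.add_apply, hx, hy]; abel

instance : LieRing (FreeLie W) where
  add_lie a b c := by simp only [← bracketHom_apply, map_add, AddMonoidHom.add_apply]
  lie_add a b c := by simp only [← bracketHom_apply, map_add]
  lie_self := bracketHom_self
  leibniz_lie := bracketHom_jac

/-- A function on trees which behaves like a left multiplication is compatible with relators. -/
theorem lift_map_node {A : Type} [AddCommGroup A] (f : BTree W → A) (T : BTree W)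
    (g : FreeAbelianGroup (BTree W) →+ A) (h : ∀ t, f (.node T t) = g (.of t))
    (x : FreeAbelianGroup (BTree W)) :
    FreeAbelianGroup.lift f (FreeAbelianGroup.map (BTree.node T) x) = g x := by
  have : (FreeAbelianGroup.lift f).comp (FreeAbelianGroup.map (BTree.node T)) = g :=
    FreeAbelianGroup.lift_ext _ _ fun t => by simp [FreeAbelianGroup.map_of_apply, h]
  exact DFunLike.congr_fun this x

/-- The universal property of the free Lie ring. -/
def lift {G : Type} [LieRing G] (f : W → G) : FreeLie W →+ G :=
  desc (FreeAbelianGroup.lift (BTree.eval f)) fun x hx => by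
    induction hx with
    | sq A => simp [BTree.eval]
    | anti A B =>
      simp only [map_add, FreeAbelianGroup.lift_apply_of, BTree.eval]
      rw [← lie_skew, neg_add_cancel]
    | jac A B C =>
      simp only [map_sub, FreeAbelianGroup.lift_apply_of, BTree.eval]
      rw [leibniz_lie]; abel
    | @left A x _ ih =>
      rw [lift_map_node _ _ ((lieBiadd G (BTree.eval f A)).comp
        (FreeAbelianGroup.lift (BTree.eval f))) fun t => by simp [BTree.eval]]
      simp [ih]

theorem lift_mk {G : Type} [LieRing G] (f : W → G) (t : BTree W) : lift f (mk t) = t.eval f := by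
  rw [lift, desc_mk, FreeAbelianGroup.lift_apply_of]

/-- Two biadditive maps on free Lie rings agree if they agree on trees. -/
theorem hom_ext₂ {V A : Type} [AddCommGroup A] {f g : FreeLie W →+ FreeLie V →+ A}
    (h : ∀ s t, f (mk s) (mk t) = g (mk s) (mk t)) : f = g :=
  hom_ext fun s => hom_ext fun t => h s t

theorem lift_lie {G : Type} [LieRing G] (f : W → G) (a b : FreeLie W) :
    lift f ⁅a, b⁆ = ⁅lift f a, lift f b⁆ := by
  have : (lieBiadd (FreeLie W)).compr₂ (lift f) =
      ((lieBiadd G).comp (lift f)).compl₂ (lift f) :=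
    hom_ext₂ fun s t => by simp [← mk_node, lift_mk, BTree.eval]
  exact DFunLike.congr_fun (DFunLike.congr_fun this a) b

/-- The class of a one-letter tree. -/
def gen (w : W) : FreeLie W := mk (.leaf w)

theorem lift_gen {G : Type} [LieRing G] (f : W → G) (w : W) : lift f (gen w) = f w := lift_mk f _

/-- Induction for predicates on the free Lie ring that are preserved by brackets. -/
theorem lie_induction {p : FreeLie W → Prop} (x : FreeLie W) (hgen : ∀ w, p (gen w))
    (hlie : ∀ x y, p x → p y → p ⁅x, y⁆)
    (h0 : p 0) (hneg : ∀ x, p x → p (-x)) (hadd : ∀ x y, p x → p y → p (x + y)) : p x := by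
  refine induction_on x (fun t => ?_) h0 hneg hadd
  induction t with
  | leaf w => exact hgen w
  | node a b ha hb => rw [mk_node]; exact hlie _ _ ha hb

end FreeLie

namespace FreeLie

variable {W : Type}

/-- The derivation `a ↦ (r ↦ a ⊗ r)` on trees, extending `w ↦ (r ↦ w ⊗ r)` on letters. -/
noncomputable def tensTree : BTree W → FreeLie W →+ (W →₀ FreeLie W)
  | .leaf w => Finsupp.singleAddHom w
  | .node a b => (tensTree a).comp (lieBiadd _ (mk b)) - (tensTree b).comp (lieBiadd _ (mk a))

theorem lift_tensTree_map_node (A : BTree W) (x : FreeAbelianGroup (BTree W)) (r : FreeLie W) :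
    FreeAbelianGroup.lift tensTree (FreeAbelianGroup.map (BTree.node A) x) r =
      tensTree A ⁅proj x, r⁆ - FreeAbelianGroup.lift tensTree x ⁅mk A, r⁆ := by
  induction x using FreeAbelianGroup.induction_on with
  | zero => simp
  | of t => simp [FreeAbelianGroup.map_of_apply, tensTree, proj_of]
  | neg t ih => simp only [map_neg, AddMonoidHom.neg_apply, ih, neg_lie]; abel
  | add x y hx hy => simp only [map_add, AddMonoidHom.add_apply, hx, hy, add_lie]; abel

/-- The biadditive map `L × L → V ⊗ L` which is the identity on `V × L` and a derivation in
the first variable. -/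
noncomputable def tens : FreeLie W →+ FreeLie W →+ (W →₀ FreeLie W) :=
  desc (FreeAbelianGroup.lift tensTree) fun x hx => by
    induction hx with
    | sq A => ext1 r; simp [tensTree]
    | anti A B => ext1 r; simp [tensTree]
    | jac A B C => ext1 r; simp [tensTree, mk_node, lie_lie]; abel
    | @left A x hx ih => ext1 r; simp [lift_tensTree_map_node, ih, proj_relator hx]

theorem tens_mk (t : BTree W) : tens (mk t) = tensTree t := by
  rw [tens, desc_mk, FreeAbelianGroup.lift_apply_of]

theorem tens_gen (w : W) (r : FreeLie W) : tens (gen w) r = Finsupp.single w r := by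
  rw [gen, tens_mk]; rfl

theorem tens_lie (a b r : FreeLie W) : tens ⁅a, b⁆ r = tens a ⁅b, r⁆ - tens b ⁅a, r⁆ := by
  induction a using induction_on with
  | hmk s =>
    induction b using induction_on with
    | hmk t => rw [← mk_node, tens_mk, tens_mk, tens_mk]; rfl
    | h0 => simp
    | hneg x h => simp only [lie_neg, neg_lie, map_neg, AddMonoidHom.neg_apply, h]; abel
    | hadd x y hx hy =>
      simp only [lie_add, add_lie, map_add, AddMonoidHom.add_apply, hx, hy]; abel
  | h0 => simp
  | hneg x h => simp only [neg_lie, map_neg, AddMonoidHom.neg_apply, h]; abel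
  | hadd x y hx hy => simp only [add_lie, map_add, AddMonoidHom.add_apply, hx, hy]; abel

/-- The bracket map `V ⊗ L → L`. -/
noncomputable def brV : (W →₀ FreeLie W) →+ FreeLie W :=
  Finsupp.liftAddHom fun w => lieBiadd _ (gen w)

theorem brV_single (w : W) (r : FreeLie W) : brV (Finsupp.single w r) = ⁅gen w, r⁆ := by
  simp [brV]

theorem brV_tens (a r : FreeLie W) : brV (tens a r) = ⁅a, r⁆ := by
  induction a using lie_induction generalizing r with
  | hgen w => rw [tens_gen, brV_single]
  | hlie x y hx hy => rw [tens_lie, map_sub, hx, hy, lie_lie]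
  | h0 => simp
  | hneg x h => simp [h]
  | hadd x y hx hy => simp [hx, hy]

end FreeLie

open BTree in
/-- Relators for the universal invariant symmetric form on the free Lie ring. -/
inductive FormRelator {W : Type} : FreeAbelianGroup (BTree W × BTree W) → Prop
  | symm (a b : BTree W) : FormRelator (.of (a, b) - .of (b, a))
  | slide (a b c : BTree W) : FormRelator (.of (node a b, c) - .of (a, node b c))
  | sq (a b : BTree W) : FormRelator (.of (node a a, b))
  | anti (a b c : BTree W) : FormRelator (.of (node a b, c) + .of (node b a, c))
  | jac (a b c d : BTree W) : FormRelator (.of (node a (node b c), d)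
      - .of (node (node a b) c, d) - .of (node b (node a c), d))

/-- The target of the universal invariant symmetric form on the free Lie ring. -/
def InvForm (W : Type) : Type :=
  FreeAbelianGroup (BTree W × BTree W) ⧸ AddSubgroup.closure {x | FormRelator (W := W) x}

namespace InvForm

variable {W : Type}

instance : AddCommGroup (InvForm W) :=
  inferInstanceAs (AddCommGroup (FreeAbelianGroup _ ⧸ AddSubgroup.closure _))

/-- The projection from formal sums of pairs of trees. -/
def proj : FreeAbelianGroup (BTree W × BTree W) →+ InvForm W := QuotientAddGroup.mk' _

/-- The class of a pair of trees. -/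
def mk (s t : BTree W) : InvForm W := proj (.of (s, t))

theorem proj_of (s t : BTree W) : proj (.of (s, t)) = mk s t := rfl

theorem proj_surjective : Function.Surjective (proj (W := W)) :=
  QuotientAddGroup.mk'_surjective _

theorem proj_relator {x : FreeAbelianGroup (BTree W × BTree W)} (h : FormRelator x) :
    proj x = 0 :=
  (QuotientAddGroup.eq_zero_iff x).2 (AddSubgroup.subset_closure h)

/-- Additive maps out of `InvForm`. -/
def desc {A : Type} [AddCommGroup A] (f : BTree W → BTree W → A)
    (h : ∀ x, FormRelator x → FreeAbelianGroup.lift (fun p => f p.1 p.2) x = 0) :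
    InvForm W →+ A :=
  QuotientAddGroup.lift _ (FreeAbelianGroup.lift fun p => f p.1 p.2)
    ((AddSubgroup.closure_le _).2 h)

theorem desc_mk {A : Type} [AddCommGroup A] (f : BTree W → BTree W → A) (h) (s t) :
    desc f h (mk s t) = f s t :=
  FreeAbelianGroup.lift_apply_of (fun p : BTree W × BTree W => f p.1 p.2) (s, t)

theorem hom_ext {A : Type} [AddCommGroup A] {f g : InvForm W →+ A}
    (h : ∀ s t, f (mk s t) = g (mk s t)) : f = g := by
  have : f.comp proj = g.comp proj := FreeAbelianGroup.lift_ext _ _ fun p => h p.1 p.2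
  ext x
  obtain ⟨x, rfl⟩ := proj_surjective x
  exact DFunLike.congr_fun this x

theorem mk_symm (s t : BTree W) : mk s t = mk t s := by
  simpa only [map_sub, proj_of, sub_eq_zero] using proj_relator (.symm s t)

theorem mk_slide (a b c : BTree W) : mk (.node a b) c = mk a (.node b c) := by
  simpa only [map_sub, proj_of, sub_eq_zero] using proj_relator (.slide a b c)

theorem lift_mk_relator {x : FreeAbelianGroup (BTree W)} (hx : LieRelator x) (a : BTree W) :
    FreeAbelianGroup.lift (mk a) x = 0 := by
  induction hx generalizing a with
  | sq A =>
    rw [FreeAbelianGroup.lift_apply_of, mk_symm]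
    exact proj_relator (.sq A a)
  | anti A B =>
    simpa only [map_add, proj_of, FreeAbelianGroup.lift_apply_of, mk_symm _ a]
      using proj_relator (.anti A B a)
  | jac A B C =>
    simpa only [map_sub, proj_of, FreeAbelianGroup.lift_apply_of, mk_symm _ a]
      using proj_relator (.jac A B C a)
  | @left A x _ ih =>
    rw [FreeLie.lift_map_node (mk a) A (FreeAbelianGroup.lift (mk (.node a A))) fun t => by
      rw [FreeAbelianGroup.lift_apply_of, mk_slide], ih]

/-- Pairing with a tree. -/
def formTree (a : BTree W) : FreeLie W →+ InvForm W :=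
  FreeLie.desc (FreeAbelianGroup.lift (mk a)) fun _ hx => lift_mk_relator hx a

theorem formTree_mk (a b : BTree W) : formTree a (.mk b) = mk a b := by
  rw [formTree, FreeLie.desc_mk, FreeAbelianGroup.lift_apply_of]

theorem lift_formTree (x : FreeAbelianGroup (BTree W)) (t : BTree W) :
    FreeAbelianGroup.lift formTree x (.mk t) = FreeAbelianGroup.lift (mk t) x := by
  induction x using FreeAbelianGroup.induction_on with
  | zero => simp
  | of s => simp [formTree_mk, mk_symm s t]
  | neg s ih => simp only [map_neg, AddMonoidHom.neg_apply, ih]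
  | add x y hx hy => simp only [map_add, AddMonoidHom.add_apply, hx, hy]

/-- The universal invariant symmetric form. -/
def form : FreeLie W →+ FreeLie W →+ InvForm W :=
  FreeLie.desc (FreeAbelianGroup.lift formTree)
    fun x hx => FreeLie.hom_ext fun t => by
      rw [AddMonoidHom.zero_apply, lift_formTree, lift_mk_relator hx t]

theorem form_mk (s t : BTree W) : form (.mk s) (.mk t) = mk s t := by
  rw [form, FreeLie.desc_mk, FreeAbelianGroup.lift_apply_of, formTree_mk]

theorem form_symm (a b : FreeLie W) : form a b = form b a := by
  have : (form (W := W)) = form.flip :=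
    FreeLie.hom_ext₂ fun s t => by simp [form_mk, mk_symm s t]
  exact DFunLike.congr_fun (DFunLike.congr_fun this a) b

theorem form_lie (a b c : FreeLie W) : form ⁅a, b⁆ c = form a ⁅b, c⁆ := by
  induction a using FreeLie.induction_on with
  | hmk s =>
    induction b using FreeLie.induction_on with
    | hmk t =>
      induction c using FreeLie.induction_on with
      | hmk u => rw [← FreeLie.mk_node, ← FreeLie.mk_node, form_mk, form_mk, mk_slide]
      | h0 => simp
      | hneg x h => simp only [lie_neg, map_neg, h]
      | hadd x y hx hy => simp only [lie_add, map_add, hx, hy]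
    | h0 => simp
    | hneg x h => simp only [lie_neg, neg_lie, map_neg, AddMonoidHom.neg_apply, h]
    | hadd x y hx hy => simp only [lie_add, add_lie, map_add, AddMonoidHom.add_apply, hx, hy]
  | h0 => simp
  | hneg x h => simp only [neg_lie, map_neg, AddMonoidHom.neg_apply, h]
  | hadd x y hx hy => simp only [add_lie, map_add, AddMonoidHom.add_apply, hx, hy]

/-- The universal property of `InvForm`. -/
def lift {A : Type} [AddCommGroup A] (β : FreeLie W →+ FreeLie W →+ A)
    (hs : ∀ a b, β a b = β b a) (hi : ∀ a b c, β ⁅a, b⁆ c = β a ⁅b, c⁆) : InvForm W →+ A :=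
  desc (fun s t => β (.mk s) (.mk t)) fun x hx => by
    induction hx with
    | symm a b => simp [hs (.mk a)]
    | slide a b c => simp [FreeLie.mk_node, hi]
    | sq a b => simp [FreeLie.mk_node]
    | anti a b c =>
      simp only [map_add, FreeAbelianGroup.lift_apply_of, FreeLie.mk_node]
      rw [← lie_skew (FreeLie.mk b), map_neg]; simp
    | jac a b c d =>
      simp only [map_sub, FreeAbelianGroup.lift_apply_of, FreeLie.mk_node]
      rw [leibniz_lie]; simp

theorem lift_form {A : Type} [AddCommGroup A] (β : FreeLie W →+ FreeLie W →+ A) (hs) (hi)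
    (a b : FreeLie W) : lift β hs hi (form a b) = β a b := by
  have : form.compr₂ (lift β hs hi) = β :=
    FreeLie.hom_ext₂ fun s t => by simp [form_mk, lift, desc_mk]
  exact DFunLike.congr_fun (DFunLike.congr_fun this a) b

/-- Levine's map for the free Lie ring. -/
noncomputable def eta : InvForm W →+ (W →₀ FreeLie W) :=
  lift (FreeLie.tens + FreeLie.tens.flip) (fun a b => by simp [add_comm]) fun a b c => by
    simp only [AddMonoidHom.add_apply, AddMonoidHom.flip_apply, FreeLie.tens_lie]
    rw [← lie_skew c a, ← lie_skew b a, map_neg, map_neg]; abel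

theorem eta_form (a b : FreeLie W) : eta (form a b) = FreeLie.tens a b + FreeLie.tens b a :=
  lift_form _ _ _ a b

end InvForm

open Classical in
/-- `a` if `p` holds, and `0` otherwise. -/
noncomputable def cutoff {A : Type} [Zero A] (p : Prop) (a : A) : A :=
  if p then a else 0

open InvForm in
/-- A partial section of the bracket map `V ⊗ L → L`, up to a factor two. -/
noncomputable def FreeLie.bracketSection {W : Type} :
    FreeLie W →+ (W →₀ FreeLie W) ⧸ (eta (W := W)).range :=
  desc (FreeAbelianGroup.lift fun
      | .leaf _ => 0
      | .node a b => QuotientAddGroup.mk' _ (2 • tens (mk a) (mk b))) fun x hx => by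
    induction hx with
    | sq A =>
      rw [FreeAbelianGroup.lift_apply_of]
      refine (QuotientAddGroup.eq_zero_iff _).2 ?_
      exact ⟨form (mk A) (mk A), by rw [eta_form, two_nsmul]⟩
    | anti A B =>
      rw [map_add, FreeAbelianGroup.lift_apply_of, FreeAbelianGroup.lift_apply_of]
      refine (QuotientAddGroup.eq_zero_iff _).2 ?_
      exact ⟨2 • form (mk A) (mk B), by rw [map_nsmul, eta_form, nsmul_add]⟩
    | jac A B C =>
      simp only [map_sub, FreeAbelianGroup.lift_apply_of, mk_node, tens_lie, smul_sub]
      abel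
    | @left A x hx _ =>
      rw [lift_map_node _ A (((QuotientAddGroup.mk' (eta (W := W)).range).comp
        (2 • tens (mk A))).comp proj) fun t => by simp [proj_of]]
      simp [proj_relator hx]

open InvForm in
theorem FreeLie.bracketSection_brV {W : Type} (z : W →₀ FreeLie W) :
    bracketSection (brV z) = QuotientAddGroup.mk' _ (2 • z) := by
  have : bracketSection.comp brV = (QuotientAddGroup.mk' (eta (W := W)).range).comp
      (nsmulAddMonoidHom 2) := by
    refine Finsupp.addHom_ext' fun w => hom_ext fun t => ?_
    simp only [AddMonoidHom.comp_apply, Finsupp.singleAddHom_apply, brV_single,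
      nsmulAddMonoidHom_apply]
    rw [gen, ← mk_node]
    rw [bracketSection, desc_mk, FreeAbelianGroup.lift_apply_of, ← tens_gen]
    rfl
  exact DFunLike.congr_fun this z

theorem FreeLie.exists_eta_eq_of_brV_eq_zero {W : Type} {z : W →₀ FreeLie W} (hz : brV z = 0) :
    ∃ w, InvForm.eta w = 2 • z := by
  have := bracketSection_brV z
  rw [hz, map_zero, eq_comm, QuotientAddGroup.mk'_apply, QuotientAddGroup.eq_zero_iff] at this
  exact this

namespace InvForm

variable {W : Type}

/-- The pairing `V ⊗ L → T`. -/
noncomputable def pairV : (W →₀ FreeLie W) →+ InvForm W :=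
  Finsupp.liftAddHom fun w => form (.gen w)

theorem pairV_tens (t : BTree W) (r : FreeLie W) :
    pairV (FreeLie.tens (.mk t) r) = t.letters.card • form (.mk t) r := by
  induction t generalizing r with
  | leaf w => rw [← FreeLie.gen, FreeLie.tens_gen]; simp [pairV, BTree.letters]
  | node a b ha hb =>
    rw [FreeLie.mk_node, FreeLie.tens_lie, map_sub, ha, hb, ← form_lie, ← form_lie,
      ← lie_skew (FreeLie.mk b) (FreeLie.mk a)]
    rw [map_neg, AddMonoidHom.neg_apply, smul_neg, sub_neg_eq_add, BTree.letters,
      Multiset.card_add, add_smul]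

theorem pairV_eta (s t : BTree W) :
    pairV (eta (mk s t)) = (s.letters + t.letters).card • mk s t := by
  rw [← form_mk, eta_form, map_add, pairV_tens, pairV_tens, form_symm (.mk t),
    Multiset.card_add, add_smul]

end InvForm

namespace FreeLie

variable {W : Type}

/-- The value on trees of the projection onto multidegrees satisfying `P`. -/
noncomputable def prTree (P : Multiset W → Prop) (t : BTree W) : FreeLie W :=
  cutoff (P t.letters) (mk t)

theorem prTree_node (P : Multiset W → Prop) (s t : BTree W) :
    prTree P (.node s t) = ⁅mk s, prTree (fun l => P (s.letters + l)) t⁆ := by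
  unfold prTree
  rw [BTree.letters, mk_node]
  unfold cutoff; split_ifs <;> simp

/-- The projection onto the multidegrees satisfying `P`. -/
noncomputable def pr (P : Multiset W → Prop) : FreeLie W →+ FreeLie W :=
  desc (FreeAbelianGroup.lift (prTree P)) fun x hx => by
    induction hx generalizing P with
    | sq A =>
      rw [FreeAbelianGroup.lift_apply_of, prTree, mk_node]; simp [cutoff]
    | anti A B =>
      simp only [map_add, FreeAbelianGroup.lift_apply_of, prTree, BTree.letters,
        add_comm B.letters A.letters, mk_anti A B]
      unfold cutoff; split_ifs <;> simp
    | jac A B C =>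
      simp only [map_sub, FreeAbelianGroup.lift_apply_of, prTree, BTree.letters,
        add_left_comm B.letters A.letters, add_assoc, mk_node]
      unfold cutoff; split_ifs <;> simp [lie_lie]
    | @left A x _ ih =>
      rw [lift_map_node _ A ((lieBiadd _ (mk A)).comp
        (FreeAbelianGroup.lift (prTree fun l => P (A.letters + l)))) fun t => by
          simp [prTree_node]]
      simp [ih]

theorem pr_mk (P : Multiset W → Prop) (t : BTree W) : pr P (mk t) = prTree P t := by
  rw [pr, desc_mk, FreeAbelianGroup.lift_apply_of]

theorem pr_mk_lie (P : Multiset W → Prop) (s : BTree W) (b : FreeLie W) :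
    pr P ⁅mk s, b⁆ = ⁅mk s, pr (fun l => P (s.letters + l)) b⁆ := by
  have : (pr P).comp (lieBiadd _ (mk s)) =
      (lieBiadd _ (mk s)).comp (pr fun l => P (s.letters + l)) :=
    hom_ext fun t => by simp [← mk_node, pr_mk, prTree_node]
  exact DFunLike.congr_fun this b

/-- The span of trees whose multidegree satisfies `P`. -/
def supported (P : Multiset W → Prop) : AddSubgroup (FreeLie W) :=
  AddSubgroup.closure (mk '' {t | P t.letters})

theorem mk_mem_supported {P : Multiset W → Prop} {t : BTree W} (h : P t.letters) :
    mk t ∈ supported P :=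
  AddSubgroup.subset_closure ⟨t, h, rfl⟩

theorem supported_le_iff {P : Multiset W → Prop} {H : AddSubgroup (FreeLie W)} :
    supported P ≤ H ↔ ∀ t : BTree W, P t.letters → mk t ∈ H := by
  rw [supported, AddSubgroup.closure_le, Set.image_subset_iff]; rfl

theorem map_mem_of_mem_supported {A : Type} [AddCommGroup A] {P : Multiset W → Prop}
    {f : FreeLie W →+ A} {H : AddSubgroup A} (h : ∀ t : BTree W, P t.letters → f (mk t) ∈ H)
    {c : FreeLie W} (hc : c ∈ supported P) : f c ∈ H :=
  (supported_le_iff (H := H.comap f)).2 h hc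

theorem eqOn_supported {A : Type} [AddCommGroup A] {P : Multiset W → Prop}
    {f g : FreeLie W →+ A} (h : ∀ t : BTree W, P t.letters → f (mk t) = g (mk t))
    {c : FreeLie W} (hc : c ∈ supported P) : f c = g c := by
  have := map_mem_of_mem_supported (f := f - g) (H := ⊥)
    (fun t ht => by simp [h t ht]) hc
  simpa [sub_eq_zero] using this

theorem supported_mono {P Q : Multiset W → Prop} (h : ∀ l, P l → Q l) :
    supported P ≤ supported Q :=
  supported_le_iff.2 fun _ ht => mk_mem_supported (h _ ht)

theorem supported_true (c : FreeLie W) : c ∈ supported fun _ => True := by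
  induction c using induction_on with
  | hmk t => exact mk_mem_supported trivial
  | h0 => exact zero_mem _
  | hneg x h => exact neg_mem h
  | hadd x y hx hy => exact add_mem hx hy

theorem lie_mem_supported {P Q R : Multiset W → Prop} (h : ∀ l l', P l → Q l' → R (l + l'))
    {a b : FreeLie W} (ha : a ∈ supported P) (hb : b ∈ supported Q) :
    ⁅a, b⁆ ∈ supported R :=
  map_mem_of_mem_supported (f := (lieBiadd _).flip b)
    (fun s hs => map_mem_of_mem_supported (f := lieBiadd _ (mk s)) (fun t ht => by
      rw [lieBiadd_apply, ← mk_node]; exact mk_mem_supported (h _ _ hs ht)) hb) ha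

theorem pr_mem (P : Multiset W → Prop) (c : FreeLie W) : pr P c ∈ supported P :=
  map_mem_of_mem_supported (fun t _ => by
    rw [pr_mk, prTree]; unfold cutoff; split_ifs with h
    exacts [mk_mem_supported h, zero_mem _]) (supported_true c)

theorem pr_of_mem_not {P Q : Multiset W → Prop} (h : ∀ l, P l → ¬ Q l) {c : FreeLie W}
    (hc : c ∈ supported P) : pr Q c = 0 :=
  eqOn_supported (g := 0) (fun t ht => by rw [pr_mk, prTree, cutoff, if_neg (h _ ht)]; rfl) hc

theorem exists_sum_pr (c : FreeLie W) : ∃ F : Finset (Multiset W), ∀ F', F ⊆ F' →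
    ∑ l ∈ F', pr (· = l) c = c := by
  classical
  induction c using induction_on with
  | hmk t =>
    refine ⟨{t.letters}, fun F' h => ?_⟩
    rw [Finset.sum_eq_single t.letters]
    · simp [pr_mk, prTree, cutoff]
    · intro b _ hb; simp [pr_mk, prTree, cutoff, hb.symm]
    · intro h'; exact absurd (h (Finset.mem_singleton_self _)) h'
  | h0 => exact ⟨∅, by simp⟩
  | hneg x h =>
    obtain ⟨F, h⟩ := h
    exact ⟨F, fun F' hF => by simp only [map_neg, Finset.sum_neg_distrib, h F' hF]⟩
  | hadd x y hx hy =>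
    obtain ⟨F, hF⟩ := hx
    obtain ⟨G, hG⟩ := hy
    exact ⟨F ∪ G, fun F' h => by
      simp only [map_add, Finset.sum_add_distrib, hF F' (Finset.union_subset_left h),
        hG F' (Finset.union_subset_right h)]⟩

/-- Membership in a subgroup can be tested on multihomogeneous components. -/
theorem mem_of_forall_pr_mem {H : AddSubgroup (FreeLie W)} {c : FreeLie W}
    (h : ∀ l, pr (· = l) c ∈ H) : c ∈ H := by
  obtain ⟨F, hF⟩ := exists_sum_pr c
  rw [← hF F subset_rfl]
  exact sum_mem fun l _ => h l

/-- The projection of `V ⊗ L` onto the multidegrees satisfying `P`. -/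
noncomputable def prV (P : Multiset W → Prop) : (W →₀ FreeLie W) →+ (W →₀ FreeLie W) :=
  Finsupp.liftAddHom fun w => (Finsupp.singleAddHom w).comp (pr fun l => P ({w} + l))

theorem prV_single (P : Multiset W → Prop) (w : W) (b : FreeLie W) :
    prV P (Finsupp.single w b) = Finsupp.single w (pr (fun l => P ({w} + l)) b) := by
  simp [prV]

theorem prV_tens (P : Multiset W → Prop) (s : BTree W) (r : FreeLie W) :
    prV P (tens (mk s) r) = tens (mk s) (pr (fun l => P (s.letters + l)) r) := by
  induction s generalizing r P with
  | leaf w => rw [← gen, tens_gen, prV_single, tens_gen]; rfl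
  | node a b ha hb =>
    simp only [mk_node, tens_lie, map_sub, ha, hb, pr_mk_lie, BTree.letters, add_assoc,
      add_left_comm b.letters a.letters]

end FreeLie

namespace InvForm

variable {W : Type}

/-- The value on pairs of trees of the projection onto multidegrees satisfying `P`. -/
noncomputable def prPair (P : Multiset W → Prop) (s t : BTree W) : InvForm W :=
  cutoff (P (s.letters + t.letters)) (mk s t)

/-- The projection of `InvForm` onto the multidegrees satisfying `P`. -/
noncomputable def pr (P : Multiset W → Prop) : InvForm W →+ InvForm W :=
  desc (prPair P) fun x hx => by
    induction hx with
    | symm a b => simp [prPair, add_comm b.letters a.letters, mk_symm a b]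
    | slide a b c => simp [prPair, BTree.letters, add_assoc, mk_slide]
    | sq a b =>
      simp only [FreeAbelianGroup.lift_apply_of, prPair, ← form_mk, FreeLie.mk_node]; simp [cutoff]
    | anti a b c =>
      simp only [map_add, FreeAbelianGroup.lift_apply_of, prPair, ← form_mk, FreeLie.mk_node,
        BTree.letters, add_comm b.letters a.letters]
      rw [← lie_skew (FreeLie.mk b) (FreeLie.mk a), map_neg]
      unfold cutoff; split_ifs <;> simp
    | jac a b c d =>
      simp only [map_sub, FreeAbelianGroup.lift_apply_of, prPair, ← form_mk, FreeLie.mk_node,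
        BTree.letters, add_left_comm b.letters a.letters, add_assoc, lie_lie]
      unfold cutoff; split_ifs <;> simp

theorem pr_mk (P : Multiset W → Prop) (s t : BTree W) : pr P (mk s t) = prPair P s t :=
  desc_mk _ _ _ _

theorem eta_pr (P : Multiset W → Prop) (u : InvForm W) :
    eta (pr P u) = FreeLie.prV P (eta u) := by
  have : (eta (W := W)).comp (pr P) = (FreeLie.prV P).comp eta := hom_ext fun s t => by
    simp only [AddMonoidHom.comp_apply, pr_mk]
    rw [← form_mk, eta_form, map_add, FreeLie.prV_tens, FreeLie.prV_tens, FreeLie.pr_mk,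
      FreeLie.pr_mk, FreeLie.prTree, FreeLie.prTree, prPair, add_comm t.letters, ← form_mk]
    unfold cutoff; split_ifs <;> simp [eta_form]
  exact DFunLike.congr_fun this u

/-- The span of pairs of trees whose multidegree satisfies `P`. -/
def supported (P : Multiset W → Prop) : AddSubgroup (InvForm W) :=
  AddSubgroup.closure ((fun p => mk p.1 p.2) ''
    {p : BTree W × BTree W | P (p.1.letters + p.2.letters)})

theorem mk_mem_supported {P : Multiset W → Prop} {s t : BTree W}
    (h : P (s.letters + t.letters)) : mk s t ∈ supported P :=
  AddSubgroup.subset_closure ⟨(s, t), h, rfl⟩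

theorem map_mem_of_mem_supported {A : Type} [AddCommGroup A] {P : Multiset W → Prop}
    {f : InvForm W →+ A} {H : AddSubgroup A}
    (h : ∀ s t : BTree W, P (s.letters + t.letters) → f (mk s t) ∈ H)
    {c : InvForm W} (hc : c ∈ supported P) : f c ∈ H := by
  have : supported P ≤ H.comap f := by
    rw [supported, AddSubgroup.closure_le, Set.image_subset_iff]
    exact fun p hp => h p.1 p.2 hp
  exact this hc

theorem eqOn_supported {A : Type} [AddCommGroup A] {P : Multiset W → Prop}
    {f g : InvForm W →+ A}
    (h : ∀ s t : BTree W, P (s.letters + t.letters) → f (mk s t) = g (mk s t))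
    {c : InvForm W} (hc : c ∈ supported P) : f c = g c := by
  have := map_mem_of_mem_supported (f := f - g) (H := ⊥)
    (fun s t ht => by simp [h s t ht]) hc
  simpa [sub_eq_zero] using this

theorem induction_on {p : InvForm W → Prop} (x : InvForm W) (hmk : ∀ s t, p (mk s t))
    (h0 : p 0) (hneg : ∀ x, p x → p (-x)) (hadd : ∀ x y, p x → p y → p (x + y)) : p x := by
  obtain ⟨x, rfl⟩ := proj_surjective x
  induction x using FreeAbelianGroup.induction_on with
  | zero => simpa using h0
  | of t => exact hmk t.1 t.2
  | neg t ih => rw [map_neg]; exact hneg _ ih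
  | add x y hx hy => rw [map_add]; exact hadd _ _ hx hy

theorem supported_true (c : InvForm W) : c ∈ supported fun _ => True := by
  induction c using induction_on with
  | hmk s t => exact mk_mem_supported trivial
  | h0 => exact zero_mem _
  | hneg x h => exact neg_mem h
  | hadd x y hx hy => exact add_mem hx hy

theorem form_mem_supported {P Q R : Multiset W → Prop} (h : ∀ l l', P l → Q l' → R (l + l'))
    {a b : FreeLie W} (ha : a ∈ FreeLie.supported P) (hb : b ∈ FreeLie.supported Q) :
    form a b ∈ supported R :=
  FreeLie.map_mem_of_mem_supported (f := form.flip b)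
    (fun s hs => FreeLie.map_mem_of_mem_supported (f := form (.mk s)) (fun t ht => by
      rw [form_mk]; exact mk_mem_supported (h _ _ hs ht)) hb) ha

theorem pr_mem (P : Multiset W → Prop) (c : InvForm W) : pr P c ∈ supported P :=
  map_mem_of_mem_supported (fun s t _ => by
    rw [pr_mk, prPair]; unfold cutoff; split_ifs with h
    exacts [mk_mem_supported h, zero_mem _]) (supported_true c)

theorem pr_of_mem {P Q : Multiset W → Prop} (h : ∀ l, P l → Q l) {c : InvForm W}
    (hc : c ∈ supported P) : pr Q c = c :=
  eqOn_supported (g := .id _) (fun s t ht => by rw [pr_mk, prPair, cutoff, if_pos (h _ ht)]; rfl) hc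

theorem pr_of_mem_not {P Q : Multiset W → Prop} (h : ∀ l, P l → ¬ Q l) {c : InvForm W}
    (hc : c ∈ supported P) : pr Q c = 0 :=
  eqOn_supported (g := 0) (fun s t ht => by rw [pr_mk, prPair, cutoff, if_neg (h _ ht)]; rfl) hc

theorem exists_sum_pr (c : InvForm W) : ∃ F : Finset (Multiset W), ∀ F', F ⊆ F' →
    ∑ l ∈ F', pr (· = l) c = c := by
  classical
  induction c using induction_on with
  | hmk s t =>
    refine ⟨{s.letters + t.letters}, fun F' h => ?_⟩
    rw [Finset.sum_eq_single (s.letters + t.letters)]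
    · simp [pr_mk, prPair, cutoff]
    · intro b _ hb; simp [pr_mk, prPair, cutoff, hb.symm]
    · intro h'; exact absurd (h (Finset.mem_singleton_self _)) h'
  | h0 => exact ⟨∅, by simp⟩
  | hneg x h =>
    obtain ⟨F, h⟩ := h
    exact ⟨F, fun F' hF => by simp only [map_neg, Finset.sum_neg_distrib, h F' hF]⟩
  | hadd x y hx hy =>
    obtain ⟨F, hF⟩ := hx
    obtain ⟨G, hG⟩ := hy
    exact ⟨F ∪ G, fun F' h => by
      simp only [map_add, Finset.sum_add_distrib, hF F' (Finset.union_subset_left h),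
        hG F' (Finset.union_subset_right h)]⟩

/-- Membership in a subgroup can be tested on multihomogeneous components. -/
theorem mem_of_forall_pr_mem {H : AddSubgroup (InvForm W)} {c : InvForm W}
    (h : ∀ l, pr (· = l) c ∈ H) : c ∈ H := by
  obtain ⟨F, hF⟩ := exists_sum_pr c
  rw [← hF F subset_rfl]
  exact sum_mem fun l _ => h l

end InvForm

namespace FreeLie

/-! ### Derivations -/

section Derivation

variable {W : Type}

/-- The derivation extending `δ`, on trees. -/
def derivTree (δ : W → FreeLie W) : BTree W → FreeLie W
  | .leaf w => δ w
  | .node a b => ⁅derivTree δ a, mk b⁆ + ⁅mk a, derivTree δ b⁆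

/-- The derivation of the free Lie ring with prescribed values on generators. -/
def deriv (δ : W → FreeLie W) : FreeLie W →+ FreeLie W :=
  desc (FreeAbelianGroup.lift (derivTree δ)) fun x hx => by
    induction hx with
    | sq A =>
      rw [FreeAbelianGroup.lift_apply_of, derivTree, ← lie_skew, neg_add_cancel]
    | anti A B =>
      simp only [map_add, FreeAbelianGroup.lift_apply_of, derivTree]
      rw [← lie_skew (mk B) (derivTree δ A), ← lie_skew (derivTree δ B) (mk A)]
      abel
    | jac A B C =>
      simp only [map_sub, FreeAbelianGroup.lift_apply_of, derivTree, mk_node, lie_lie, add_lie,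
        lie_add]
      abel
    | @left A x hx ih =>
      rw [lift_map_node _ A (((lieBiadd _) (derivTree δ A)).comp proj +
        ((lieBiadd _) (mk A)).comp (FreeAbelianGroup.lift (derivTree δ))) fun t => by
          simp [derivTree, proj_of]]
      simp [ih, proj_relator hx]

theorem deriv_mk (δ : W → FreeLie W) (t : BTree W) : deriv δ (mk t) = derivTree δ t := by
  rw [deriv, desc_mk, FreeAbelianGroup.lift_apply_of]

theorem deriv_gen (δ : W → FreeLie W) (w : W) : deriv δ (gen w) = δ w := deriv_mk _ _

theorem deriv_lie (δ : W → FreeLie W) (a b : FreeLie W) :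
    deriv δ ⁅a, b⁆ = ⁅deriv δ a, b⁆ + ⁅a, deriv δ b⁆ := by
  have : (lieBiadd (FreeLie W)).compr₂ (deriv δ) =
      (lieBiadd _).comp (deriv δ) + (lieBiadd _).compl₂ (deriv δ) :=
    hom_ext₂ fun s t => by simp [← mk_node, deriv_mk, derivTree]
  exact DFunLike.congr_fun (DFunLike.congr_fun this a) b

end Derivation

/-! ### Words -/

section Words

variable {W : Type}

/-- Prepending a letter, as an operator on formal sums of words. -/
noncomputable def consOp (w : W) : Module.End ℤ (List W →₀ ℤ) :=
  Finsupp.lmapDomain ℤ ℤ (List.cons w)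

theorem consOp_single (w : W) (v : List W) (n : ℤ) :
    consOp w (Finsupp.single v n) = Finsupp.single (w :: v) n :=
  Finsupp.mapDomain_single

noncomputable instance : LieRing (Module.End ℤ (List W →₀ ℤ)) := LieRing.ofAssociativeRing

/-- The action of the free Lie ring on formal sums of words. -/
noncomputable def wordAction : FreeLie W →+ Module.End ℤ (List W →₀ ℤ) :=
  lift (G := Module.End ℤ (List W →₀ ℤ)) (consOp (W := W))

theorem wordAction_gen (w : W) : wordAction (gen w) = consOp w := lift_gen _ _

theorem wordAction_lie (a b : FreeLie W) (f : List W →₀ ℤ) :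
    wordAction ⁅a, b⁆ f = wordAction a (wordAction b f) - wordAction b (wordAction a f) := by
  rw [wordAction, lift_lie]; rfl

open Classical in
/-- The projection of formal sums of words onto a multidegree. -/
noncomputable def wordPr (l : Multiset W) : (List W →₀ ℤ) →+ (List W →₀ ℤ) :=
  Finsupp.filterAddHom fun v : List W => (v : Multiset W) = l

open Classical in
theorem wordPr_apply (l : Multiset W) (f : List W →₀ ℤ) (v : List W) :
    wordPr l f v = if (v : Multiset W) = l then f v else 0 := by
  exact Finsupp.filter_apply _ _ _

open Classical in
theorem wordPr_single (l : Multiset W) (v : List W) (n : ℤ) :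
    wordPr l (Finsupp.single v n) = if (v : Multiset W) = l then Finsupp.single v n else 0 := by
  ext u
  rw [wordPr_apply]
  by_cases h : v = u
  · subst h; split_ifs <;> rfl
  · rw [Finsupp.single_eq_of_ne (Ne.symm h)]
    split_ifs <;> simp [Finsupp.single_eq_of_ne (Ne.symm h)]

theorem wordPr_wordAction (t : BTree W) (l : Multiset W) (f : List W →₀ ℤ) :
    wordPr (t.letters + l) (wordAction (mk t) f) = wordAction (mk t) (wordPr l f) := by
  induction t generalizing l f with
  | leaf w =>
    rw [← gen, wordAction_gen]
    have : (wordPr ({w} + l)).comp (consOp w).toAddMonoidHom =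
        (consOp w).toAddMonoidHom.comp (wordPr l) := by
      refine Finsupp.addHom_ext fun v n => ?_
      simp only [AddMonoidHom.comp_apply, wordPr_single, LinearMap.toAddMonoidHom_coe,
        consOp_single]
      rw [Multiset.singleton_add]
      by_cases h : (v : Multiset W) = l
      · rw [if_pos h, if_pos (by rw [← h, Multiset.cons_coe]), consOp_single]
      · rw [if_neg h, if_neg (by rwa [← Multiset.cons_coe, Multiset.cons_inj_right]), map_zero]
    exact DFunLike.congr_fun this f
  | node a b ha hb =>
    rw [mk_node, wordAction_lie, wordAction_lie, map_sub, BTree.letters, add_assoc, ha, hb,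
      add_left_comm, hb, ha]

theorem wordPr_wordAction_nil (t : BTree W) :
    wordPr t.letters (wordAction (mk t) (Finsupp.single [] 1)) =
      wordAction (mk t) (Finsupp.single [] 1) := by
  have := wordPr_wordAction t 0 (Finsupp.single [] 1)
  rwa [wordPr_single, if_pos (by simp), add_zero] at this

theorem wordAction_nil_apply_of_ne {t : BTree W} {v : List W} (h : (v : Multiset W) ≠ t.letters) :
    wordAction (mk t) (Finsupp.single [] 1) v = 0 := by
  rw [← wordPr_wordAction_nil, wordPr_apply, if_neg h]

/-- The Magnus expansion. -/
noncomputable def magnus : FreeLie W →+ (List W →₀ ℤ) :=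
  AddMonoidHom.mk' (fun c => wordAction c (Finsupp.single [] 1)) fun a b => by simp

theorem magnus_apply (c : FreeLie W) : magnus c = wordAction c (Finsupp.single [] 1) := rfl

theorem magnus_pr (l : Multiset W) (c : FreeLie W) :
    magnus (pr (· = l) c) = wordPr l (magnus c) := by
  have : magnus.comp (pr (· = l)) = (wordPr l).comp magnus := hom_ext fun t => by
    simp only [AddMonoidHom.comp_apply, pr_mk, prTree, cutoff]
    split_ifs with h
    · rw [← h, magnus_apply, wordPr_wordAction_nil]
    · ext v
      rw [map_zero, wordPr_apply, magnus_apply]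
      split_ifs with hv
      · rw [wordAction_nil_apply_of_ne fun h' => h (by rw [← h', hv])]; rfl
      · rfl
  exact DFunLike.congr_fun this c

theorem magnus_apply_nil (c : FreeLie W) : magnus c [] = 0 := by
  have : (Finsupp.applyAddHom []).comp magnus = (0 : FreeLie W →+ ℤ) := hom_ext fun t => by
    refine wordAction_nil_apply_of_ne fun h => ?_
    have := t.letters_card_pos
    rw [← h] at this
    simp at this
  exact DFunLike.congr_fun this c

end Words

/-! ### The shift derivation and its split extension -/

section Shift

variable {Y : Type}

/-- The shift of an indexed letter. -/
def inc (p : ℕ × Y) : ℕ × Y := (p.1 + 1, p.2)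

/-- The derivation `(i, y) ↦ (i + 1, y)`. -/
def shift : FreeLie (ℕ × Y) →+ FreeLie (ℕ × Y) := deriv fun p => gen (inc p)

theorem shift_gen (p : ℕ × Y) : shift (gen p) = gen (inc p) := deriv_gen _ _

theorem shift_lie (a b : FreeLie (ℕ × Y)) : shift ⁅a, b⁆ = ⁅shift a, b⁆ + ⁅a, shift b⁆ :=
  deriv_lie _ _ _

theorem shift_mk_mem (t : BTree (ℕ × Y)) :
    shift (mk t) ∈ supported fun l => l.card = t.letters.card := by
  induction t with
  | leaf w => rw [← gen, shift_gen]; exact mk_mem_supported (by simp [BTree.letters])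
  | node a b ha hb =>
    rw [mk_node, shift_lie]
    refine add_mem (lie_mem_supported (P := fun l => l.card = a.letters.card)
      (Q := fun l => l.card = b.letters.card) ?_ ha (mk_mem_supported rfl))
      (lie_mem_supported (P := fun l => l.card = a.letters.card)
      (Q := fun l => l.card = b.letters.card) ?_ (mk_mem_supported rfl) hb)
    all_goals intro l l' h h'; simp [BTree.letters, h, h']

/-- The split extension of the free Lie ring on `ℕ × Y` by the shift derivation. -/
def ShiftExt (Y : Type) : Type := FreeLie (ℕ × Y) × ℤ

instance : AddCommGroup (ShiftExt Y) := inferInstanceAs (AddCommGroup (FreeLie (ℕ × Y) × ℤ))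

instance : Bracket (ShiftExt Y) (ShiftExt Y) :=
  ⟨fun p q => (⁅p.1, q.1⁆ + p.2 • shift q.1 - q.2 • shift p.1, 0)⟩

instance : LieRing (ShiftExt Y) where
  add_lie := by
    rintro ⟨a, i⟩ ⟨b, j⟩ ⟨c, k⟩
    refine Prod.ext ?_ (add_zero (0 : ℤ)).symm
    change ⁅a + b, c⁆ + (i + j) • shift c - k • shift (a + b) =
      ⁅a, c⁆ + i • shift c - k • shift a + (⁅b, c⁆ + j • shift c - k • shift b)
    simp only [add_lie, map_add, add_smul, smul_add]; abel
  lie_add := by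
    rintro ⟨a, i⟩ ⟨b, j⟩ ⟨c, k⟩
    refine Prod.ext ?_ (add_zero (0 : ℤ)).symm
    change ⁅a, b + c⁆ + i • shift (b + c) - (j + k) • shift a =
      ⁅a, b⁆ + i • shift b - j • shift a + (⁅a, c⁆ + i • shift c - k • shift a)
    simp only [lie_add, map_add, add_smul, smul_add]; abel
  lie_self := by
    rintro ⟨a, i⟩
    refine Prod.ext ?_ rfl
    change ⁅a, a⁆ + i • shift a - i • shift a = 0
    simp
  leibniz_lie := by
    rintro ⟨a, i⟩ ⟨b, j⟩ ⟨c, k⟩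
    refine Prod.ext ?_ (add_zero (0 : ℤ)).symm
    change ⁅a, ⁅b, c⁆ + j • shift c - k • shift b⁆ +
        i • shift (⁅b, c⁆ + j • shift c - k • shift b) - (0 : ℤ) • shift a =
      (⁅⁅a, b⁆ + i • shift b - j • shift a, c⁆ + (0 : ℤ) • shift c -
        k • shift (⁅a, b⁆ + i • shift b - j • shift a)) +
      (⁅b, ⁅a, c⁆ + i • shift c - k • shift a⁆ +
        j • shift (⁅a, c⁆ + i • shift c - k • shift a) - (0 : ℤ) • shift b)
    simp only [lie_add, lie_sub, add_lie, sub_lie, map_add, map_sub, map_zsmul, shift_lie,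
      smul_add, smul_sub, lie_zsmul, zsmul_lie, zero_smul, lie_lie, smul_comm j i,
      smul_comm k i, smul_comm k j]
    rw [← lie_skew (shift a) b]
    simp only [smul_neg]
    abel

end Shift

end FreeLie

namespace FreeLie

/-! ### Eliminating a letter -/

section Elimination

variable {W : Type} (x : W)

/-- The letters other than `x`, with an index. -/
abbrev ElimLetter {W : Type} (x : W) : Type := ℕ × {w : W // w ≠ x}

/-- The image `ad_x ^ i (y)` of an indexed letter. -/
def adPow (p : ElimLetter x) : FreeLie W := (fun b => ⁅gen x, b⁆)^[p.1] (gen p.2.1)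

theorem adPow_inc (p : ElimLetter x) : adPow x (inc p) = ⁅gen x, adPow x p⁆ :=
  Function.iterate_succ_apply' _ _ _

/-- The inclusion of the ideal generated by the letters other than `x`. -/
def elimIncl : FreeLie (ElimLetter x) →+ FreeLie W := lift (adPow x)

theorem elimIncl_gen (p : ElimLetter x) : elimIncl x (gen p) = adPow x p := lift_gen _ _

theorem elimIncl_lie (a b : FreeLie (ElimLetter x)) :
    elimIncl x ⁅a, b⁆ = ⁅elimIncl x a, elimIncl x b⁆ := lift_lie _ _ _

theorem elimIncl_shift (b : FreeLie (ElimLetter x)) :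
    elimIncl x (shift b) = ⁅gen x, elimIncl x b⁆ := by
  induction b using lie_induction with
  | hgen w => rw [shift_gen, elimIncl_gen, elimIncl_gen, adPow_inc]
  | hlie a b ha hb =>
    rw [shift_lie, map_add, elimIncl_lie, elimIncl_lie, elimIncl_lie, ha, hb, ← leibniz_lie]
  | h0 => simp
  | hneg a h => simp [h]
  | hadd a b ha hb => simp [ha, hb]

open Classical in
/-- The isomorphism of the free Lie ring with the split extension, on letters. -/
noncomputable def elimGen (w : W) : ShiftExt {w : W // w ≠ x} :=
  if h : w = x then ((0, 1) : FreeLie (ElimLetter x) × ℤ)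
  else ((gen (0, ⟨w, h⟩), 0) : FreeLie (ElimLetter x) × ℤ)

/-- The isomorphism of the free Lie ring with the split extension. -/
noncomputable def elim : FreeLie W →+ ShiftExt {w : W // w ≠ x} := lift (elimGen x)

theorem elim_gen_self : elim x (gen x) = ((0, 1) : FreeLie (ElimLetter x) × ℤ) :=
  (lift_gen _ _).trans (dif_pos rfl)

theorem elim_gen_of_ne {w : W} (h : w ≠ x) :
    elim x (gen w) = ((gen (0, ⟨w, h⟩), 0) : FreeLie (ElimLetter x) × ℤ) :=
  (lift_gen _ _).trans (dif_neg h)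

theorem elim_lie (a b : FreeLie W) : elim x ⁅a, b⁆ = ⁅elim x a, elim x b⁆ := lift_lie _ _ _

/-- The component of `elim` in the free Lie ring on the indexed letters. -/
noncomputable def elimFst : FreeLie W →+ FreeLie (ElimLetter x) :=
  AddMonoidHom.mk' (fun a => (elim x a).1) fun a b => congrArg Prod.fst (map_add (elim x) a b)

/-- The coefficient of the letter `x`. -/
noncomputable def letterCoeff : FreeLie W →+ ℤ :=
  AddMonoidHom.mk' (fun a => (elim x a).2) fun a b => congrArg Prod.snd (map_add (elim x) a b)

theorem elimFst_gen_self : elimFst x (gen x) = 0 := congrArg Prod.fst (elim_gen_self x)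

theorem elimFst_gen_of_ne {w : W} (h : w ≠ x) : elimFst x (gen w) = gen (0, ⟨w, h⟩) :=
  congrArg Prod.fst (elim_gen_of_ne x h)

theorem letterCoeff_gen_self : letterCoeff x (gen x) = 1 := congrArg Prod.snd (elim_gen_self x)

theorem letterCoeff_gen_of_ne {w : W} (h : w ≠ x) : letterCoeff x (gen w) = 0 :=
  congrArg Prod.snd (elim_gen_of_ne x h)

theorem elimFst_lie (a b : FreeLie W) : elimFst x ⁅a, b⁆ = ⁅elimFst x a, elimFst x b⁆ +
    letterCoeff x a • shift (elimFst x b) - letterCoeff x b • shift (elimFst x a) :=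
  congrArg Prod.fst (elim_lie x a b)

theorem letterCoeff_lie (a b : FreeLie W) : letterCoeff x ⁅a, b⁆ = 0 :=
  congrArg Prod.snd (elim_lie x a b)

theorem elimIncl_elimFst (a : FreeLie W) :
    elimIncl x (elimFst x a) + letterCoeff x a • gen x = a := by
  induction a using lie_induction with
  | hgen w =>
    by_cases h : w = x
    · subst h; simp [elimFst_gen_self, letterCoeff_gen_self]
    · simp [elimFst_gen_of_ne x h, letterCoeff_gen_of_ne x h, elimIncl_gen, adPow]
  | hlie a b ha hb =>
    conv_rhs => rw [← ha, ← hb]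
    simp only [elimFst_lie, letterCoeff_lie, map_add, map_sub, map_zsmul, elimIncl_lie,
      elimIncl_shift, lie_add, add_lie, lie_zsmul, zsmul_lie, lie_self, smul_zero, zero_smul]
    rw [← lie_skew (elimIncl x (elimFst x a)) (gen x)]
    simp only [smul_neg, add_zero]
    abel
  | h0 => simp
  | hneg a h =>
    conv_rhs => rw [← h]
    simp only [map_neg, neg_smul, neg_add]
  | hadd a b ha hb =>
    conv_rhs => rw [← ha, ← hb]
    simp only [map_add, add_smul]; abel

theorem elimIncl_elimFst_of_letterCoeff {a : FreeLie W} (h : letterCoeff x a = 0) :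
    elimIncl x (elimFst x a) = a := by
  simpa [h] using elimIncl_elimFst x a

theorem letterCoeff_mk_node (a b : BTree W) : letterCoeff x (mk (.node a b)) = 0 := by
  rw [mk_node, letterCoeff_lie]

theorem letterCoeff_mk_of_ne {t : BTree W} (h : t ≠ .leaf x) : letterCoeff x (mk t) = 0 := by
  cases t with
  | leaf w => exact letterCoeff_gen_of_ne x fun h' => h (by rw [h'])
  | node a b => exact letterCoeff_mk_node x a b

theorem adPow_elim (p : ElimLetter x) :
    elimFst x (adPow x p) = gen p ∧ letterCoeff x (adPow x p) = 0 := by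
  obtain ⟨i, y, hy⟩ := p
  induction i with
  | zero => exact ⟨elimFst_gen_of_ne x hy, letterCoeff_gen_of_ne x hy⟩
  | succ i ih =>
    have := adPow_inc x (i, ⟨y, hy⟩)
    rw [inc] at this
    rw [this, elimFst_lie, letterCoeff_lie, ih.1, ih.2, elimFst_gen_self, letterCoeff_gen_self]
    simp [shift_gen, inc]

theorem letterCoeff_elimIncl (b : FreeLie (ElimLetter x)) :
    letterCoeff x (elimIncl x b) = 0 := by
  induction b using lie_induction with
  | hgen w => rw [elimIncl_gen, (adPow_elim x w).2]
  | hlie a b ha hb => rw [elimIncl_lie, letterCoeff_lie]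
  | h0 => simp
  | hneg a h => simp [h]
  | hadd a b ha hb => simp [ha, hb]

theorem elimFst_elimIncl (b : FreeLie (ElimLetter x)) : elimFst x (elimIncl x b) = b := by
  induction b using lie_induction with
  | hgen w => rw [elimIncl_gen, (adPow_elim x w).1]
  | hlie a b ha hb =>
    rw [elimIncl_lie, elimFst_lie, ha, hb, letterCoeff_elimIncl, letterCoeff_elimIncl]; simp
  | h0 => simp
  | hneg a h => simp [h]
  | hadd a b ha hb => simp [ha, hb]

theorem shift_mem_supported_card {k : ℕ} {b : FreeLie (ElimLetter x)}
    (hb : b ∈ supported fun l => l.card ≤ k) : shift b ∈ supported fun l => l.card ≤ k :=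
  map_mem_of_mem_supported (fun t ht => supported_mono (fun _ h => h.trans_le ht)
    (shift_mk_mem t)) hb

open Classical in
theorem elimFst_mk_mem (t : BTree W) : elimFst x (mk t) ∈
    supported fun l => l.card ≤ t.letters.card - t.letters.count x := by
  have hle (t : BTree W) : t.letters.count x ≤ t.letters.card := Multiset.count_le_card _ _
  induction t with
  | leaf w =>
    by_cases h : w = x
    · subst h; rw [← gen, elimFst_gen_self]; exact zero_mem _
    · rw [← gen, elimFst_gen_of_ne x h]
      refine mk_mem_supported ?_
      simp [BTree.letters, Ne.symm h]
  | node a b ha hb =>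
    have hla := hle a
    have hlb := hle b
    rw [mk_node, elimFst_lie]
    refine sub_mem (add_mem (lie_mem_supported ?_ ha hb) ?_) ?_
    · intro l l' h h'
      simp only [BTree.letters, Multiset.card_add, Multiset.count_add]
      omega
    · by_cases h : a = .leaf x
      · refine zsmul_mem (supported_mono ?_ (shift_mem_supported_card x hb)) _
        intro l h'
        simp only [h, BTree.letters, Multiset.card_add, Multiset.count_add,
          Multiset.card_singleton, Multiset.count_singleton_self]
        omega
      · rw [letterCoeff_mk_of_ne x h, zero_smul]; exact zero_mem _
    · by_cases h : b = .leaf x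
      · refine zsmul_mem (supported_mono ?_ (shift_mem_supported_card x ha)) _
        intro l h'
        simp only [h, BTree.letters, Multiset.card_add, Multiset.count_add,
          Multiset.card_singleton, Multiset.count_singleton_self]
        omega
      · rw [letterCoeff_mk_of_ne x h, zero_smul]; exact zero_mem _

end Elimination

/-! ### Injectivity of the Magnus expansion -/

section Magnus

/-- The derivation of words `(i, y) ↦ (i + 1, y)`, on a word. -/
noncomputable def shiftWord {Y : Type} : List (ℕ × Y) → (List (ℕ × Y) →₀ ℤ)
  | [] => 0
  | a :: w => Finsupp.single (inc a :: w) 1 + consOp a (shiftWord w)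

/-- The derivation of formal sums of words `(i, y) ↦ (i + 1, y)`. -/
noncomputable def shiftOp {Y : Type} : Module.End ℤ (List (ℕ × Y) →₀ ℤ) :=
  Finsupp.linearCombination ℤ shiftWord

theorem shiftOp_single {Y : Type} (w : List (ℕ × Y)) :
    shiftOp (Finsupp.single w 1) = shiftWord w := by
  simp [shiftOp]

theorem shiftOp_consOp {Y : Type} (a : ℕ × Y) (f : List (ℕ × Y) →₀ ℤ) :
    shiftOp (consOp a f) = consOp (inc a) f + consOp a (shiftOp f) := by
  have : shiftOp ∘ₗ consOp a = consOp (inc a) + consOp a ∘ₗ shiftOp := by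
    refine Finsupp.lhom_ext' fun w => LinearMap.ext_ring ?_
    simp [consOp_single, shiftOp_single, shiftWord]
  exact LinearMap.congr_fun this f

theorem shiftOp_lie_consOp {Y : Type} (a : ℕ × Y) :
    ⁅(shiftOp : Module.End ℤ (List (ℕ × Y) →₀ ℤ)), consOp a⁆ = consOp (inc a) := by
  refine LinearMap.ext fun f => ?_
  change shiftOp (consOp a f) - consOp a (shiftOp f) = _
  rw [shiftOp_consOp]; abel

theorem wordAction_shift {Y : Type} (c : FreeLie (ℕ × Y)) :
    wordAction (shift c) = ⁅(shiftOp : Module.End ℤ (List (ℕ × Y) →₀ ℤ)), wordAction c⁆ := by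
  induction c using lie_induction with
  | hgen w => rw [shift_gen, wordAction_gen, wordAction_gen, shiftOp_lie_consOp]
  | hlie a b ha hb =>
    have h (a b : FreeLie (ℕ × Y)) : wordAction ⁅a, b⁆ = ⁅wordAction a, wordAction b⁆ :=
      lift_lie _ _ _
    rw [shift_lie, map_add, h, h, h, ha, hb, ← leibniz_lie]
  | h0 => simp
  | hneg a h => rw [map_neg, map_neg, map_neg, h, lie_neg]
  | hadd a b ha hb => rw [map_add, map_add, map_add, ha, hb, lie_add]

variable {W : Type} (x : W)

open Classical in
/-- The operator by which a letter acts on words in the indexed letters. -/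
noncomputable def elimOp (w : W) : Module.End ℤ (List (ElimLetter x) →₀ ℤ) :=
  if h : w = x then shiftOp else consOp (0, ⟨w, h⟩)

/-- The action of the free Lie ring on words in the indexed letters. -/
noncomputable def elimAction : FreeLie W →+ Module.End ℤ (List (ElimLetter x) →₀ ℤ) :=
  lift (elimOp x)

theorem elimAction_gen (w : W) : elimAction x (gen w) = elimOp x w := lift_gen _ _

theorem elimAction_lie (a b : FreeLie W) :
    elimAction x ⁅a, b⁆ = ⁅elimAction x a, elimAction x b⁆ := lift_lie _ _ _

theorem elimAction_adPow (p : ElimLetter x) : elimAction x (adPow x p) = consOp p := by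
  obtain ⟨i, y, hy⟩ := p
  induction i with
  | zero => exact (elimAction_gen x y).trans (dif_neg hy)
  | succ i ih =>
    have := adPow_inc x (i, ⟨y, hy⟩)
    rw [inc] at this
    rw [this, elimAction_lie, ih, elimAction_gen, elimOp, dif_pos rfl, shiftOp_lie_consOp]
    rfl

theorem elimAction_elimIncl (b : FreeLie (ElimLetter x)) :
    elimAction x (elimIncl x b) = wordAction b := by
  induction b using lie_induction with
  | hgen w => rw [elimIncl_gen, elimAction_adPow, wordAction_gen]
  | hlie a b ha hb =>
    rw [elimIncl_lie, elimAction_lie, ha, hb]; exact (lift_lie _ _ _).symm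
  | h0 => simp
  | hneg a h => simp [h]
  | hadd a b ha hb => simp [ha, hb]

/-- The result of letting the letters of a word act on `m`. -/
noncomputable def wordEval (m : List (ElimLetter x) →₀ ℤ) :
    List W → (List (ElimLetter x) →₀ ℤ)
  | [] => m
  | w :: v => elimOp x w (wordEval m v)

theorem elimAction_linearCombination (m : List (ElimLetter x) →₀ ℤ) (c : FreeLie W)
    (f : List W →₀ ℤ) : elimAction x c (Finsupp.linearCombination ℤ (wordEval x m) f) =
      Finsupp.linearCombination ℤ (wordEval x m) (wordAction c f) := by
  induction c using lie_induction generalizing f with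
  | hgen w =>
    have : elimOp x w ∘ₗ Finsupp.linearCombination ℤ (wordEval x m) =
        Finsupp.linearCombination ℤ (wordEval x m) ∘ₗ consOp w := by
      refine Finsupp.lhom_ext' fun w => LinearMap.ext_ring ?_
      simp [consOp_single, wordEval]
    rw [elimAction_gen, wordAction_gen]
    exact LinearMap.congr_fun this f
  | hlie a b ha hb =>
    rw [elimAction_lie, wordAction_lie, map_sub, ← ha, ← hb, ← hb, ← ha]; rfl
  | h0 => simp
  | hneg a h => simp [h]
  | hadd a b ha hb => simp [ha, hb]

theorem magnus_elimFst {c : FreeLie W} (hx : letterCoeff x c = 0) (h : magnus c = 0) :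
    magnus (elimFst x c) = 0 := by
  rw [magnus_apply, ← elimAction_elimIncl, elimIncl_elimFst_of_letterCoeff x hx]
  have := elimAction_linearCombination x (Finsupp.single [] 1) c (Finsupp.single [] 1)
  rw [← magnus_apply, h, map_zero] at this
  simpa [wordEval] using this

theorem letterCoeff_eq_magnus (c : FreeLie W) : letterCoeff x c = magnus c [x] := by
  have : letterCoeff x = (Finsupp.applyAddHom [x]).comp magnus := hom_ext fun t => by
    change _ = magnus (mk t) [x]
    cases t with
    | leaf w =>
      rw [← gen, magnus_apply, wordAction_gen, consOp_single]
      by_cases h : w = x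
      · subst h; simp [letterCoeff_gen_self]
      · rw [letterCoeff_gen_of_ne x h, Finsupp.single_eq_of_ne]; simpa using Ne.symm h
    | node a b =>
      rw [letterCoeff_mk_node, magnus_apply, wordAction_nil_apply_of_ne]
      intro h
      have := congrArg Multiset.card h
      have ha := a.letters_card_pos
      have hb := b.letters_card_pos
      simp only [BTree.letters, Multiset.card_add, Multiset.coe_card, List.length_singleton] at this
      omega
  exact DFunLike.congr_fun this c

theorem eq_zero_of_mem_supported_false {P : Multiset W → Prop} {c : FreeLie W}
    (hc : c ∈ supported P) (h : ∀ l, P l → l.card = 0) : c = 0 :=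
  eqOn_supported (f := .id _) (g := 0)
    (fun t ht => absurd (h _ ht) t.letters_card_pos.ne') hc

theorem eq_zero_of_magnus_of_card_le (N : ℕ) : ∀ {W : Type} {c : FreeLie W},
    c ∈ supported (fun l => l.card ≤ N) → magnus c = 0 → c = 0 := by
  classical
  induction N with
  | zero => exact fun hc _ => eq_zero_of_mem_supported_false hc fun _ => Nat.le_zero.1
  | succ N ih =>
    intro W c hc h0
    refine mem_of_forall_pr_mem (H := ⊥) fun l => ?_
    rw [AddSubgroup.mem_bot]
    by_cases hl : l.card ≤ N + 1
    swap
    · exact pr_of_mem_not (fun l' h' e => hl (by rwa [← e])) hc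
    obtain rfl | ⟨x, hx⟩ := l.empty_or_exists_mem
    · exact eq_zero_of_mem_supported_false (pr_mem _ _) fun l h => by simp [h]
    have hm : magnus (pr (· = l) c) = 0 := by rw [magnus_pr, h0, map_zero]
    have hc' : letterCoeff x (pr (· = l) c) = 0 := by rw [letterCoeff_eq_magnus, hm]; rfl
    rw [← elimIncl_elimFst_of_letterCoeff x hc', ih ?_ (magnus_elimFst x hc' hm), map_zero]
    refine map_mem_of_mem_supported (fun t ht => supported_mono (fun l' hl' => ?_)
      (elimFst_mk_mem x t)) (pr_mem (· = l) c)
    have := Multiset.count_pos.2 hx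
    rw [← ht] at this hl
    omega

theorem exists_mem_supported_card_le (c : FreeLie W) :
    ∃ N, c ∈ supported fun l => l.card ≤ N := by
  induction c using induction_on with
  | hmk t => exact ⟨_, mk_mem_supported le_rfl⟩
  | h0 => exact ⟨0, zero_mem _⟩
  | hneg x h => exact h.imp fun _ => neg_mem
  | hadd x y hx hy =>
    obtain ⟨N, hN⟩ := hx
    obtain ⟨M, hM⟩ := hy
    exact ⟨N + M, add_mem (supported_mono (fun l h => h.trans (Nat.le_add_right _ _)) hN)
      (supported_mono (fun l h => h.trans (Nat.le_add_left _ _)) hM)⟩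

theorem eq_zero_of_magnus_eq_zero {c : FreeLie W} (h : magnus c = 0) : c = 0 :=
  (exists_mem_supported_card_le c).elim fun N hN => eq_zero_of_magnus_of_card_le N hN h

end Magnus

/-! ### Injectivity of the shift -/

section ShiftInjective

variable {Y : Type}

open Classical in
/-- Removal of a given first letter, on a word. -/
noncomputable def tailWord (a : ℕ × Y) : List (ℕ × Y) → (List (ℕ × Y) →₀ ℤ)
  | [] => 0
  | b :: w => if b = a then Finsupp.single w 1 else 0

/-- Removal of a given first letter. -/
noncomputable def tailOp (a : ℕ × Y) : Module.End ℤ (List (ℕ × Y) →₀ ℤ) :=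
  Finsupp.linearCombination ℤ (tailWord a)

theorem tailOp_single (a : ℕ × Y) (w : List (ℕ × Y)) :
    tailOp a (Finsupp.single w 1) = tailWord a w := by
  simp [tailOp]

theorem tailOp_apply (a : ℕ × Y) (f : List (ℕ × Y) →₀ ℤ) (w : List (ℕ × Y)) :
    tailOp a f w = f (a :: w) := by
  have : Finsupp.lapply w ∘ₗ tailOp a = Finsupp.lapply (R := ℤ) (M := ℤ) (a :: w) := by
    classical
    refine Finsupp.lhom_ext' fun v => LinearMap.ext_ring ?_
    simp only [LinearMap.comp_apply, Finsupp.lsingle_apply, tailOp_single, Finsupp.lapply_apply]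
    cases v with
    | nil => simp [tailWord]
    | cons b v =>
      by_cases h : b = a
      · subst h; simp [tailWord, Finsupp.single_apply]
      · simp [tailWord, h]
  exact LinearMap.congr_fun this f

open Classical in
theorem tailOp_consOp (a b : ℕ × Y) (f : List (ℕ × Y) →₀ ℤ) :
    tailOp a (consOp b f) = if b = a then f else 0 := by
  have : tailOp a ∘ₗ consOp b = if b = a then LinearMap.id else 0 := by
    refine Finsupp.lhom_ext' fun v => LinearMap.ext_ring ?_
    simp only [LinearMap.comp_apply, Finsupp.lsingle_apply, consOp_single, tailOp_single, tailWord]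
    split_ifs <;> simp
  have := LinearMap.congr_fun this f
  simp only [LinearMap.comp_apply] at this
  rw [this]
  split_ifs <;> simp

theorem tailOp_inc_shiftOp (a : ℕ × Y) (f : List (ℕ × Y) →₀ ℤ) :
    tailOp (inc a) (shiftOp f) = tailOp a f + shiftOp (tailOp (inc a) f) := by
  have : tailOp (inc a) ∘ₗ shiftOp = tailOp a + shiftOp ∘ₗ tailOp (inc a) := by
    refine Finsupp.lhom_ext' fun v => LinearMap.ext_ring ?_
    simp only [LinearMap.comp_apply, Finsupp.lsingle_apply, shiftOp_single, tailOp_single,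
      LinearMap.add_apply]
    cases v with
    | nil => simp [shiftWord, tailWord]
    | cons b v =>
      have hinj : inc b = inc a ↔ b = a := by simp [inc, Prod.ext_iff]
      simp only [shiftWord, map_add, tailOp_single, tailWord, tailOp_consOp]
      congr 1
      · by_cases h : b = a
        · rw [if_pos (hinj.2 h), if_pos h]
        · rw [if_neg fun h' => h (hinj.1 h'), if_neg h]
      · split_ifs
        · rw [shiftOp_single]
        · rw [map_zero]
  exact LinearMap.congr_fun this f

theorem eq_zero_of_shiftOp_eq_zero {f : List (ℕ × Y) →₀ ℤ} (h : shiftOp f = 0) (h0 : f [] = 0) :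
    f = 0 := by
  have hdown (i : ℕ) (y : Y) (hi : tailOp (i + 1, y) f = 0) : tailOp (i, y) f = 0 := by
    have := tailOp_inc_shiftOp (i, y) f
    rw [inc] at this
    simpa [h, hi] using this.symm
  have hlarge : ∃ N, ∀ i y, N ≤ i → tailOp (i, y) f = 0 := by
    refine ⟨(f.support.sup fun w => (w.map fun a => a.1 + 1).sum), fun i y hi => ?_⟩
    ext w
    rw [tailOp_apply]
    by_contra hne
    have := Finset.le_sup (f := fun w : List (ℕ × Y) => (w.map fun a => a.1 + 1).sum)
      (Finsupp.mem_support_iff.2 hne)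
    simp only [List.map_cons, List.sum_cons] at this
    omega
  obtain ⟨N, hN⟩ := hlarge
  have hall : ∀ n i y, N ≤ i + n → tailOp (i, y) f = 0 := by
    intro n
    induction n with
    | zero => exact hN
    | succ n ih => exact fun i y hi => hdown i y (ih (i + 1) y (by omega))
  ext w
  cases w with
  | nil => exact h0
  | cons a w =>
    rw [← tailOp_apply, hall N a.1 a.2 (by omega)]; rfl

theorem eq_zero_of_shift_eq_zero {c : FreeLie (ℕ × Y)} (h : shift c = 0) : c = 0 := by
  refine eq_zero_of_magnus_eq_zero (eq_zero_of_shiftOp_eq_zero ?_ (magnus_apply_nil c))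
  have := LinearMap.congr_fun (wordAction_shift c) (Finsupp.single [] 1)
  rw [h, map_zero] at this
  change 0 = shiftOp (magnus c) - wordAction c (shiftOp (Finsupp.single [] 1)) at this
  simpa [shiftOp_single, shiftWord] using this.symm

end ShiftInjective

end FreeLie

/-! ### The kernel of `eta` is torsion of two-power order -/

namespace FreeLie

section ShiftTensor

variable {Y : Type}

/-- The powers of the negative of the shift. -/
def negShift : ℕ → FreeLie (ℕ × Y) →+ FreeLie (ℕ × Y)
  | 0 => .id _
  | i + 1 => -(negShift i).comp shift

/-- The derivation of `V ⊗ L` induced by the shift. -/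
noncomputable def shiftV : ((ℕ × Y) →₀ FreeLie (ℕ × Y)) →+ ((ℕ × Y) →₀ FreeLie (ℕ × Y)) :=
  Finsupp.liftAddHom fun p => Finsupp.singleAddHom (inc p) + (Finsupp.singleAddHom p).comp shift

theorem shiftV_single (p : ℕ × Y) (b : FreeLie (ℕ × Y)) :
    shiftV (Finsupp.single p b) = Finsupp.single (inc p) b + Finsupp.single p (shift b) := by
  simp [shiftV]

/-- The map identifying `V ⊗ L` modulo the image of the shift with a direct sum of copies
of `L`. -/
noncomputable def shiftCoker : ((ℕ × Y) →₀ FreeLie (ℕ × Y)) →+ (Y →₀ FreeLie (ℕ × Y)) :=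
  Finsupp.liftAddHom fun p => (Finsupp.singleAddHom p.2).comp (negShift p.1)

theorem shiftCoker_single (p : ℕ × Y) (b : FreeLie (ℕ × Y)) :
    shiftCoker (Finsupp.single p b) = Finsupp.single p.2 (negShift p.1 b) := by
  simp [shiftCoker]

/-- The inclusion of the letters of index zero. -/
noncomputable def baseV : (Y →₀ FreeLie (ℕ × Y)) →+ ((ℕ × Y) →₀ FreeLie (ℕ × Y)) :=
  Finsupp.liftAddHom fun y => Finsupp.singleAddHom (0, y)

theorem sub_baseV_shiftCoker_mem (z : (ℕ × Y) →₀ FreeLie (ℕ × Y)) :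
    z - baseV (shiftCoker z) ∈ (shiftV (Y := Y)).range := by
  induction z using Finsupp.induction_linear with
  | zero => simp
  | add f g hf hg =>
    rw [map_add, map_add, add_sub_add_comm]
    exact add_mem hf hg
  | single p b =>
    obtain ⟨i, y⟩ := p
    rw [shiftCoker_single]
    induction i generalizing b with
    | zero => simp [negShift, baseV]
    | succ i ih =>
      have h : (Finsupp.single (i + 1, y) b : (ℕ × Y) →₀ FreeLie (ℕ × Y)) =
          shiftV (Finsupp.single (i, y) b) - Finsupp.single (i, y) (shift b) := by
        rw [shiftV_single, inc, add_sub_cancel_right]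
      have h' : (Finsupp.single y (negShift (i + 1) b) : Y →₀ FreeLie (ℕ × Y)) =
          -Finsupp.single y (negShift i (shift b)) := by
        rw [← Finsupp.single_neg]; rfl
      change Finsupp.single (i + 1, y) b - baseV (Finsupp.single y (negShift (i + 1) b)) ∈ _
      rw [h, h', map_neg, sub_neg_eq_add, sub_add]
      exact sub_mem ⟨Finsupp.single (i, y) b, rfl⟩ (ih (shift b))

theorem exists_shiftV_eq {z : (ℕ × Y) →₀ FreeLie (ℕ × Y)} (h : shiftCoker z = 0) :
    ∃ z', shiftV z' = z := by
  have := sub_baseV_shiftCoker_mem z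
  rwa [h, map_zero, sub_zero] at this

theorem brV_shiftV (z : (ℕ × Y) →₀ FreeLie (ℕ × Y)) : brV (shiftV z) = shift (brV z) := by
  induction z using Finsupp.induction_linear with
  | zero => simp
  | add f g hf hg => simp [hf, hg]
  | single p b => rw [shiftV_single, map_add, brV_single, brV_single, brV_single, shift_lie,
      shift_gen]

theorem shiftV_tens (a b : FreeLie (ℕ × Y)) :
    shiftV (tens a b) = tens (shift a) b + tens a (shift b) := by
  induction a using lie_induction generalizing b with
  | hgen p => rw [tens_gen, shiftV_single, shift_gen, tens_gen, tens_gen]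
  | hlie a a' ha ha' =>
    simp only [tens_lie, shift_lie, map_sub, map_add, ha, ha', AddMonoidHom.add_apply]
    abel
  | h0 => simp
  | hneg a h => simp only [map_neg, AddMonoidHom.neg_apply, h, neg_add]
  | hadd a a' ha ha' =>
    simp only [map_add, AddMonoidHom.add_apply, ha, ha']
    abel

end ShiftTensor

section ElimTensor

variable {W : Type} (x : W)

open Classical in
/-- Elimination of the letter `x` in `V ⊗ L`. -/
noncomputable def elimV : (W →₀ FreeLie W) →+ ({w : W // w ≠ x} →₀ FreeLie (ElimLetter x)) :=
  Finsupp.liftAddHom fun w =>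
    if h : w = x then 0 else (Finsupp.singleAddHom ⟨w, h⟩).comp (elimFst x)

theorem elimV_single_self (b : FreeLie W) : elimV x (Finsupp.single x b) = 0 := by
  simp [elimV]

theorem elimV_single_of_ne {w : W} (h : w ≠ x) (b : FreeLie W) :
    elimV x (Finsupp.single w b) = Finsupp.single ⟨w, h⟩ (elimFst x b) := by
  simp [elimV, h]

theorem elimV_tens_elimIncl (a b : FreeLie (ElimLetter x)) :
    elimV x (tens (elimIncl x a) (elimIncl x b)) = shiftCoker (tens a b) := by
  induction a using lie_induction generalizing b with
  | hgen p =>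
    obtain ⟨i, y, hy⟩ := p
    rw [elimIncl_gen, tens_gen, shiftCoker_single]
    induction i generalizing b with
    | zero =>
      refine (congrArg _ (tens_gen y _)).trans ?_
      rw [elimV_single_of_ne x hy, elimFst_elimIncl]; rfl
    | succ i ih =>
      have := adPow_inc x (i, ⟨y, hy⟩)
      rw [inc] at this
      rw [this, tens_lie, map_sub, tens_gen, elimV_single_self, zero_sub, ← elimIncl_shift, ih,
        ← Finsupp.single_neg]
      rfl
  | hlie a a' ha ha' =>
    rw [elimIncl_lie, tens_lie, tens_lie, map_sub, map_sub, ← elimIncl_lie, ← elimIncl_lie, ha,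
      ha']
  | h0 => simp
  | hneg a h => simp only [map_neg, AddMonoidHom.neg_apply, h]
  | hadd a a' ha ha' => simp only [map_add, AddMonoidHom.add_apply, ha, ha']

end ElimTensor

end FreeLie

namespace InvForm

open FreeLie

theorem brV_eta {W : Type} (u : InvForm W) : brV (eta u) = 0 := by
  induction u using induction_on with
  | hmk s t => rw [← form_mk, eta_form, map_add, brV_tens, brV_tens, ← lie_skew, neg_add_cancel]
  | h0 => simp
  | hneg u h => simp [h]
  | hadd u v hu hv => simp [hu, hv]

/-- The derivation of `InvForm` induced by the shift. -/
def shiftT {Y : Type} : InvForm (ℕ × Y) →+ InvForm (ℕ × Y) :=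
  lift (form.comp shift + form.compl₂ shift)
    (fun a b => by
      change form (shift a) b + form a (shift b) = form (shift b) a + form b (shift a)
      rw [form_symm (shift a), form_symm a, add_comm])
    fun a b c => by
      change form (shift ⁅a, b⁆) c + form ⁅a, b⁆ (shift c) =
        form (shift a) ⁅b, c⁆ + form a (shift ⁅b, c⁆)
      simp only [shift_lie, map_add, AddMonoidHom.add_apply, form_lie]
      abel

theorem shiftT_form {Y : Type} (a b : FreeLie (ℕ × Y)) :
    shiftT (form a b) = form (shift a) b + form a (shift b) := lift_form _ _ _ a b

theorem eta_shiftT {Y : Type} (u : InvForm (ℕ × Y)) : eta (shiftT u) = shiftV (eta u) := by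
  induction u using induction_on with
  | hmk s t =>
    rw [← form_mk, shiftT_form, map_add, eta_form, eta_form, eta_form, map_add, shiftV_tens,
      shiftV_tens]
    abel
  | h0 => simp
  | hneg u h => simp [h]
  | hadd u v hu hv => simp [hu, hv]

theorem pr_shiftT {Y : Type} (N : ℕ) (u : InvForm (ℕ × Y)) :
    pr (fun l => l.card ≤ N) (shiftT u) = shiftT (pr (fun l => l.card ≤ N) u) := by
  induction u using induction_on with
  | hmk s t =>
    have hm : shiftT (mk s t) ∈ supported fun l => l.card = (s.letters + t.letters).card := by
      rw [← form_mk, shiftT_form, Multiset.card_add]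
      refine add_mem
        (form_mem_supported ?_ (shift_mk_mem s) (FreeLie.mk_mem_supported (P := (· = t.letters)) rfl))
        (form_mem_supported ?_ (FreeLie.mk_mem_supported (P := (· = s.letters)) rfl) (shift_mk_mem t))
      all_goals intro l l' h h'; simp [h, h']
    rw [pr_mk, prPair, cutoff]
    split_ifs with h
    · exact pr_of_mem (fun l hl => hl.trans_le h) hm
    · rw [map_zero]; exact pr_of_mem_not (fun l hl hl' => h (hl.symm.trans_le hl')) hm
  | h0 => simp
  | hneg u h => simp [h]
  | hadd u v hu hv => simp [hu, hv]

section Elimination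

variable {W : Type} (x : W)

/-- The map induced on `InvForm` by `FreeLie.elimIncl`. -/
def elimInclT : InvForm (ElimLetter x) →+ InvForm W :=
  lift ((form.comp (elimIncl x)).compl₂ (elimIncl x)) (fun a b => form_symm _ _) fun a b c => by
    change form (elimIncl x ⁅a, b⁆) (elimIncl x c) = form (elimIncl x a) (elimIncl x ⁅b, c⁆)
    rw [elimIncl_lie, elimIncl_lie, form_lie]

theorem elimInclT_form (a b : FreeLie (ElimLetter x)) :
    elimInclT x (form a b) = form (elimIncl x a) (elimIncl x b) := lift_form _ _ _ a b

theorem elimInclT_shiftT (u : InvForm (ElimLetter x)) : elimInclT x (shiftT u) = 0 := by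
  induction u using induction_on with
  | hmk s t =>
    rw [← form_mk, shiftT_form, map_add, elimInclT_form, elimInclT_form, elimIncl_shift,
      elimIncl_shift, ← form_lie, ← lie_skew, map_neg, AddMonoidHom.neg_apply, neg_add_cancel]
  | h0 => simp
  | hneg u h => simp [h]
  | hadd u v hu hv => simp [hu, hv]

theorem elimV_eta_elimInclT (u : InvForm (ElimLetter x)) :
    elimV x (eta (elimInclT x u)) = shiftCoker (eta u) := by
  induction u using induction_on with
  | hmk s t =>
    rw [← form_mk, elimInclT_form, eta_form, eta_form, map_add, map_add, elimV_tens_elimIncl,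
      elimV_tens_elimIncl]
  | h0 => simp
  | hneg u h => simp [h]
  | hadd u v hu hv => simp [hu, hv]

theorem mk_mem_map_elimInclT_of_ne {N : ℕ} {s t : BTree W} (hs : s ≠ .leaf x) (ht : t ≠ .leaf x)
    (hx : x ∈ s.letters + t.letters) (hN : (s.letters + t.letters).card ≤ N + 1) :
    mk s t ∈ (supported fun l => l.card ≤ N).map (elimInclT x) := by
  classical
  refine ⟨form (elimFst x (.mk s)) (elimFst x (.mk t)),
    form_mem_supported ?_ (elimFst_mk_mem x s) (elimFst_mk_mem x t), ?_⟩
  · intro l l' h h'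
    have h₁ := Multiset.count_pos.2 hx
    have h₂ := Multiset.count_le_card x s.letters
    have h₃ := Multiset.count_le_card x t.letters
    rw [Multiset.count_add] at h₁
    rw [Multiset.card_add] at hN ⊢
    omega
  · rw [elimInclT_form, elimIncl_elimFst_of_letterCoeff x (letterCoeff_mk_of_ne x hs),
      elimIncl_elimFst_of_letterCoeff x (letterCoeff_mk_of_ne x ht), form_mk]

theorem mk_leaf_mem_map_elimInclT {N : ℕ} {t : BTree W} (ht : 2 ≤ t.letters.card)
    (hN : (({x} : Multiset W) + t.letters).card ≤ N + 1) :
    mk (.leaf x) t ∈ (supported fun l => l.card ≤ N).map (elimInclT x) := by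
  cases t with
  | leaf w => simp [BTree.letters] at ht
  | node a b =>
    rw [← mk_slide]
    by_cases hb : b = .leaf x
    · rw [hb, mk_symm, ← mk_slide, ← form_mk, mk_node, lie_self, map_zero]
      exact zero_mem _
    · refine mk_mem_map_elimInclT_of_ne x (by simp) hb (by simp [BTree.letters]) ?_
      simpa [BTree.letters, add_assoc] using hN

theorem mk_mem_map_elimInclT {N : ℕ} {s t : BTree W} (hx : x ∈ s.letters + t.letters)
    (h3 : 3 ≤ (s.letters + t.letters).card) (hN : (s.letters + t.letters).card ≤ N + 1) :
    mk s t ∈ (supported fun l => l.card ≤ N).map (elimInclT x) := by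
  by_cases hs : s = .leaf x
  · subst hs
    refine mk_leaf_mem_map_elimInclT x ?_ hN
    simp [BTree.letters] at h3; omega
  by_cases ht : t = .leaf x
  · subst ht
    rw [mk_symm]
    refine mk_leaf_mem_map_elimInclT x ?_ (by rw [add_comm]; exact hN)
    simp [BTree.letters] at h3; omega
  exact mk_mem_map_elimInclT_of_ne x hs ht hx hN

end Elimination

/-- The elements killed by a power of two. -/
def twoTorsion (A : Type) [AddCommGroup A] : AddSubgroup A where
  carrier := {u | ∃ j : ℕ, 2 ^ j • u = 0}
  zero_mem' := ⟨0, by simp⟩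
  neg_mem' := fun ⟨j, h⟩ => ⟨j, by rw [smul_neg, h, neg_zero]⟩
  add_mem' := by
    rintro u v ⟨i, hi⟩ ⟨j, hj⟩
    refine ⟨i + j, ?_⟩
    rw [smul_add]
    nth_rewrite 1 [add_comm i j]
    rw [pow_add, pow_add, mul_smul, mul_smul, hi, hj, smul_zero, smul_zero, add_zero]

theorem pairV_eta_of_mem {W : Type} {l : Multiset W} {u : InvForm W}
    (hu : u ∈ supported (· = l)) : pairV (eta u) = l.card • u :=
  eqOn_supported (f := pairV.comp eta) (g := nsmulAddMonoidHom l.card)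
    (fun s t h => by subst h; exact pairV_eta s t) hu

theorem mem_twoTorsion_of_eta_eq_zero_of_card_le (N : ℕ) : ∀ {W : Type} {u : InvForm W},
    u ∈ supported (fun l => l.card ≤ N) → eta u = 0 → u ∈ twoTorsion (InvForm W) := by
  induction N with
  | zero =>
    intro W u hu _
    refine map_mem_of_mem_supported (f := .id _) (fun s t h => ?_) hu
    have := s.letters_card_pos
    rw [Multiset.card_add] at h
    omega
  | succ N ih =>
    intro W u hu h0
    refine mem_of_forall_pr_mem fun l => ?_
    by_cases hl : l.card ≤ N + 1
    swap
    · rw [pr_of_mem_not (fun l' h' e => hl (by rwa [← e])) hu]; exact zero_mem _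
    have hm := pr_mem (· = l) u
    have he : eta (pr (· = l) u) = 0 := by rw [eta_pr, h0, map_zero]
    generalize pr (· = l) u = v at hm he
    have hp := pairV_eta_of_mem hm
    rw [he, map_zero] at hp
    obtain rfl | ⟨x, hx⟩ := l.empty_or_exists_mem
    · refine map_mem_of_mem_supported (f := .id _) (fun s t h => ?_) hm
      have := s.letters_card_pos
      have h' := congrArg Multiset.card h
      rw [Multiset.card_add, Multiset.card_zero] at h'
      omega
    by_cases h2 : l.card ≤ 2
    · have := Multiset.card_pos_iff_exists_mem.2 ⟨x, hx⟩
      obtain h1 | h1 : l.card = 1 ∨ l.card = 2 := by omega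
      · exact ⟨0, by rw [pow_zero, ← h1, ← hp]⟩
      · exact ⟨1, by rw [pow_one, ← h1, ← hp]⟩
    obtain ⟨w, hw, rfl⟩ : v ∈ (supported fun l => l.card ≤ N).map (elimInclT x) :=
      map_mem_of_mem_supported (f := .id _) (fun s t h => mk_mem_map_elimInclT x
        (by rwa [h]) (by rw [h]; omega) (by rwa [h])) hm
    obtain ⟨z, hz⟩ := exists_shiftV_eq (z := eta w) (by
      rw [← elimV_eta_elimInclT, he, map_zero])
    have hbr : brV z = 0 := eq_zero_of_shift_eq_zero (by rw [← brV_shiftV, hz, brV_eta])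
    obtain ⟨w', hw'⟩ := exists_eta_eq_of_brV_eq_zero hbr
    have hq : eta (2 • w - shiftT w') = 0 := by
      rw [map_sub, map_nsmul, eta_shiftT, hw', map_nsmul, hz, sub_self]
    have hq' : pr (fun l => l.card ≤ N) (2 • w - shiftT w') =
        2 • w - shiftT (pr (fun l => l.card ≤ N) w') := by
      rw [map_sub, map_nsmul, pr_shiftT, pr_of_mem (fun _ h => h) hw]
    obtain ⟨j, hj⟩ := ih (pr_mem (fun l => l.card ≤ N) (2 • w - shiftT w'))
      (by rw [eta_pr, hq, map_zero])
    refine ⟨j + 1, ?_⟩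
    have := congrArg (elimInclT x) hj
    rwa [hq', map_nsmul, map_sub, elimInclT_shiftT, sub_zero, map_nsmul, map_zero, ← mul_smul,
      ← pow_succ] at this

theorem exists_mem_supported_card_le {W : Type} (u : InvForm W) :
    ∃ N, u ∈ supported fun l => l.card ≤ N := by
  induction u using induction_on with
  | hmk s t => exact ⟨_, mk_mem_supported le_rfl⟩
  | h0 => exact ⟨0, zero_mem _⟩
  | hneg x h => exact h.imp fun _ => neg_mem
  | hadd x y hx hy =>
    obtain ⟨N, hN⟩ := hx
    obtain ⟨M, hM⟩ := hy
    refine ⟨N + M, add_mem ?_ ?_⟩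
    · exact map_mem_of_mem_supported (f := .id _)
        (fun s t h => mk_mem_supported (h.trans (Nat.le_add_right _ _))) hN
    · exact map_mem_of_mem_supported (f := .id _)
        (fun s t h => mk_mem_supported (h.trans (Nat.le_add_left _ _))) hM

theorem exists_pow_two_smul_eq_zero {W : Type} {u : InvForm W} (h : eta u = 0) :
    ∃ j : ℕ, 2 ^ j • u = 0 :=
  (exists_mem_supported_card_le u).elim fun N hN => mem_twoTorsion_of_eta_eq_zero_of_card_le N hN h

end InvForm

/-! ### Relations in the quasi-Lie ring and the tree groups -/

theorem Ctx.deg_fill_eq {m : ℕ} (c : Ctx m) {s t : RTree m} (h : s.deg = t.deg) :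
    (c.fill s).deg = (c.fill t).deg := by
  induction c with
  | hole => exact h
  | nodeL c r ih => simp [Ctx.fill, RTree.deg, ih]
  | nodeR l c ih => simp [Ctx.fill, RTree.deg, ih]

section LpTree

variable {m n : ℕ}

variable (n) in
/-- The class of a rooted tree in `Lp m n`. -/
def lpTree (t : RTree m) : Lp m n := LpMk m n (.of t)

theorem lpTree_eq_zero {t : RTree m} (h : t.deg ≠ n) : lpTree n t = 0 :=
  (QuotientAddGroup.eq_zero_iff _).2 <| AddSubgroup.subset_closure <|
    Or.inl (Or.inl ⟨t, h, rfl⟩)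

theorem lpTree_anti (c : Ctx m) (A B : RTree m) :
    lpTree n (c.fill (.node A B)) + lpTree n (c.fill (.node B A)) = 0 := by
  rw [lpTree, lpTree, ← map_add]
  exact (QuotientAddGroup.eq_zero_iff _).2 <| AddSubgroup.subset_closure <|
    Or.inl (Or.inr ⟨c, A, B, rfl⟩)

theorem lpTree_jac (c : Ctx m) (A B C : RTree m) :
    lpTree n (c.fill (.node A (.node B C))) - lpTree n (c.fill (.node (.node A B) C)) -
      lpTree n (c.fill (.node B (.node A C))) = 0 := by
  rw [lpTree, lpTree, lpTree, ← map_sub, ← map_sub]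
  exact (QuotientAddGroup.eq_zero_iff _).2 <| AddSubgroup.subset_closure <|
    Or.inr ⟨c, A, B, C, rfl⟩

/-- A homomorphism out of `Lp m n` given by its values on trees. -/
def lpDesc {A : Type} [AddCommGroup A] (f : RTree m → A) (h0 : ∀ t, t.deg ≠ n → f t = 0)
    (ha : ∀ c A B, f (Ctx.fill c (.node A B)) + f (c.fill (.node B A)) = 0)
    (hj : ∀ c A B C, f (Ctx.fill c (.node A (.node B C))) - f (c.fill (.node (.node A B) C)) -
      f (c.fill (.node B (.node A C))) = 0) : Lp m n →+ A :=
  QuotientAddGroup.lift _ (FreeAbelianGroup.lift f) <| (AddSubgroup.closure_le _).2 <| by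
    rintro _ ((⟨t, ht, rfl⟩ | ⟨c, A, B, rfl⟩) | ⟨c, A, B, C, rfl⟩)
    · simpa using h0 t ht
    · simpa using ha c A B
    · simpa using hj c A B C

theorem lpDesc_lpTree {A : Type} [AddCommGroup A] (f : RTree m → A) (h0 ha hj) (t : RTree m) :
    lpDesc (n := n) f h0 ha hj (lpTree n t) = f t :=
  FreeAbelianGroup.lift_apply_of f t

theorem lp_hom_ext {A : Type} [AddCommGroup A] {f g : Lp m n →+ A}
    (h : ∀ t, f (lpTree n t) = g (lpTree n t)) : f = g := by
  refine QuotientAddGroup.addMonoidHom_ext _ ?_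
  exact FreeAbelianGroup.lift_ext _ _ h

/-- Homomorphisms out of `V ⊗ Lp m n` are determined by their values on trees. -/
theorem tensor_hom_ext {A : Type} [AddCommGroup A]
    {f g : FreeAbelianGroup (Fin m) ⊗[ℤ] Lp m n →+ A}
    (h : ∀ i t, f (.of i ⊗ₜ lpTree n t) = g (.of i ⊗ₜ lpTree n t)) : f = g := by
  have h₁ (i : Fin m) (b : Lp m n) : f (.of i ⊗ₜ b) = g (.of i ⊗ₜ b) := by
    have : f.comp (TensorProduct.mk ℤ _ (Lp m n) (.of i)).toAddMonoidHom =
        g.comp (TensorProduct.mk ℤ _ (Lp m n) (.of i)).toAddMonoidHom := lp_hom_ext (h i)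
    exact DFunLike.congr_fun this b
  refine AddMonoidHom.ext fun z => ?_
  induction z using TensorProduct.induction_on with
  | zero => simp
  | add x y hx hy => simp [hx, hy]
  | tmul v b =>
    induction v using FreeAbelianGroup.induction_on with
    | zero => simp
    | of i => exact h₁ i b
    | neg i hi => simp only [TensorProduct.neg_tmul, map_neg, hi]
    | add x y hx hy => simp only [TensorProduct.add_tmul, map_add, hx, hy]

/-- The homomorphism out of `V ⊗ Lp m n` induced by homomorphisms out of `Lp m n`. -/
noncomputable def tensorDesc {A : Type} [AddCommGroup A] (f : Fin m → Lp m n →+ A) :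
    FreeAbelianGroup (Fin m) ⊗[ℤ] Lp m n →+ A :=
  (TensorProduct.lift
    (FreeAbelianGroup.lift fun i => (f i).toIntLinearMap).toIntLinearMap).toAddMonoidHom

theorem tensorDesc_tmul {A : Type} [AddCommGroup A] (f : Fin m → Lp m n →+ A) (i : Fin m)
    (b : Lp m n) : tensorDesc f (.of i ⊗ₜ b) = f i b := by
  change FreeAbelianGroup.lift (fun i => (f i).toIntLinearMap) (.of i) b = _
  rw [FreeAbelianGroup.lift_apply_of]
  rfl

theorem bracketLp_tmul (i : Fin m) (t : RTree m) :
    bracketLp m n (.of i ⊗ₜ lpTree n t) = lpTree (n + 1) (.node (.leaf i) t) := by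
  change FreeAbelianGroup.lift (fun i => (brLeaf m n i).toIntLinearMap) (.of i) (lpTree n t) = _
  rw [FreeAbelianGroup.lift_apply_of]
  change LpMk m (n + 1) (brLeafFree m i (.of t)) = _
  rw [brLeafFree, FreeAbelianGroup.lift_apply_of]
  rfl

end LpTree

section TPair

variable {m n : ℕ}

variable (n) in
/-- The class of a pair of rooted trees in `Tgrp m n`. -/
def tPair (s t : RTree m) : Tgrp m n := TMk m n (.of (s, t))

theorem tPair_eq_zero {s t : RTree m} (h : s.deg + t.deg ≠ n + 2) : tPair n s t = 0 :=
  (QuotientAddGroup.eq_zero_iff _).2 <| AddSubgroup.subset_closure <|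
    Or.inl (Or.inl (Or.inl (Or.inl ⟨(s, t), h, rfl⟩)))

theorem tPair_symm (s t : RTree m) : tPair n s t = tPair n t s := by
  rw [← sub_eq_zero, tPair, tPair, ← map_sub]
  exact (QuotientAddGroup.eq_zero_iff _).2 <| AddSubgroup.subset_closure <|
    Or.inl (Or.inl (Or.inl (Or.inr ⟨s, t, rfl⟩)))

theorem tPair_slide (A B C : RTree m) : tPair n (.node A B) C = tPair n A (.node B C) := by
  rw [← sub_eq_zero, tPair, tPair, ← map_sub]
  exact (QuotientAddGroup.eq_zero_iff _).2 <| AddSubgroup.subset_closure <|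
    Or.inl (Or.inl (Or.inr ⟨A, B, C, rfl⟩))

theorem tPair_node_anti (A B C : RTree m) :
    tPair n (.node A B) C + tPair n (.node B A) C = 0 := by
  rw [tPair, tPair, ← map_add]
  exact (QuotientAddGroup.eq_zero_iff _).2 <| AddSubgroup.subset_closure <|
    Or.inl (Or.inr ⟨A, B, C, rfl⟩)

theorem tPair_node_jac (A B C D : RTree m) : tPair n (.node A (.node B C)) D -
    tPair n (.node (.node A B) C) D - tPair n (.node B (.node A C)) D = 0 := by
  rw [tPair, tPair, tPair, ← map_sub, ← map_sub]
  exact (QuotientAddGroup.eq_zero_iff _).2 <| AddSubgroup.subset_closure <|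
    Or.inr ⟨A, B, C, D, rfl⟩

theorem tPair_anti (D : RTree m) (c : Ctx m) (A B : RTree m) :
    tPair n D (c.fill (.node A B)) + tPair n D (c.fill (.node B A)) = 0 := by
  induction c generalizing D with
  | hole =>
    rw [tPair_symm, tPair_symm D]
    exact tPair_node_anti A B D
  | nodeL c r ih =>
    simp only [Ctx.fill]
    rw [tPair_symm, tPair_symm D, tPair_slide, tPair_slide, tPair_symm, tPair_symm (c.fill _)]
    exact ih _
  | nodeR l c ih =>
    simp only [Ctx.fill]
    rw [← tPair_slide, ← tPair_slide]
    exact ih _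

theorem tPair_jac (D : RTree m) (c : Ctx m) (A B C : RTree m) :
    tPair n D (c.fill (.node A (.node B C))) - tPair n D (c.fill (.node (.node A B) C)) -
      tPair n D (c.fill (.node B (.node A C))) = 0 := by
  induction c generalizing D with
  | hole =>
    rw [tPair_symm, tPair_symm D, tPair_symm D]
    exact tPair_node_jac A B C D
  | nodeL c r ih =>
    simp only [Ctx.fill]
    simp only [tPair_symm D, tPair_slide]
    simp only [tPair_symm _ (.node r D)]
    exact ih _
  | nodeR l c ih =>
    simp only [Ctx.fill]
    rw [← tPair_slide, ← tPair_slide, ← tPair_slide]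
    exact ih _

/-- A homomorphism out of `Tgrp m n` given by its values on pairs of trees. -/
def tDesc {A : Type} [AddCommGroup A] (f : RTree m → RTree m → A)
    (h0 : ∀ s t, s.deg + t.deg ≠ n + 2 → f s t = 0) (hs : ∀ s t, f s t - f t s = 0)
    (hl : ∀ A B C, f (.node A B) C - f A (.node B C) = 0)
    (ha : ∀ A B C, f (.node A B) C + f (.node B A) C = 0)
    (hj : ∀ A B C D, f (.node A (.node B C)) D - f (.node (.node A B) C) D -
      f (.node B (.node A C)) D = 0) : Tgrp m n →+ A :=
  QuotientAddGroup.lift _ (FreeAbelianGroup.lift fun p => f p.1 p.2) <|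
    (AddSubgroup.closure_le _).2 <| by
    rintro _ ((((⟨p, hp, rfl⟩ | ⟨A, B, rfl⟩) | ⟨A, B, C, rfl⟩) | ⟨A, B, C, rfl⟩) |
      ⟨A, B, C, D, rfl⟩)
    · simpa using h0 p.1 p.2 hp
    · simpa using hs A B
    · simpa using hl A B C
    · simpa using ha A B C
    · simpa using hj A B C D

theorem tDesc_tPair {A : Type} [AddCommGroup A] (f : RTree m → RTree m → A) (h0 hs hl ha hj)
    (s t : RTree m) : tDesc (n := n) f h0 hs hl ha hj (tPair n s t) = f s t :=
  FreeAbelianGroup.lift_apply_of (fun p : RTree m × RTree m => f p.1 p.2) (s, t)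

theorem t_hom_ext {A : Type} [AddCommGroup A] {f g : Tgrp m n →+ A}
    (h : ∀ s t, f (tPair n s t) = g (tPair n s t)) : f = g := by
  refine QuotientAddGroup.addMonoidHom_ext _ ?_
  exact FreeAbelianGroup.lift_ext _ _ fun p => h p.1 p.2

end TPair

/-! ### Rerooting sums -/

section Reroot

variable {m n : ℕ}

variable (n) in
/-- The sum of `X_v ⊗ t_v` over the leaves `v` of `a`, where `t_v` is `⟨a, r⟩` rerooted at `v`. -/
noncomputable def rerootSum (a r : RTree m) : FreeAbelianGroup (Fin m) ⊗[ℤ] Lp m n :=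
  ((rerootList a r).map fun v => FreeAbelianGroup.of v.1 ⊗ₜ[ℤ] lpTree n v.2).sum

theorem rerootSum_leaf (i : Fin m) (r : RTree m) :
    rerootSum n (.leaf i) r = FreeAbelianGroup.of i ⊗ₜ[ℤ] lpTree n r := by
  simp [rerootSum, rerootList]

theorem rerootSum_node (a b r : RTree m) :
    rerootSum n (.node a b) r = rerootSum n a (.node b r) + rerootSum n b (.node r a) := by
  simp [rerootSum, rerootList]

theorem deg_add_one_of_mem_rerootList {a r : RTree m} {v : Fin m × RTree m}
    (hv : v ∈ rerootList a r) : v.2.deg + 1 = a.deg + r.deg := by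
  induction a generalizing r with
  | leaf i =>
    obtain rfl := List.mem_singleton.1 hv
    exact add_comm _ _
  | node a b ha hb =>
    rw [rerootList, List.mem_append] at hv
    rcases hv with h | h
    · have := ha h; simp only [RTree.deg] at this ⊢; omega
    · have := hb h; simp only [RTree.deg] at this ⊢; omega

theorem rerootSum_eq_zero {a r : RTree m} (h : a.deg + r.deg ≠ n + 1) :
    rerootSum n a r = 0 := by
  refine List.sum_eq_zero fun x hx => ?_
  obtain ⟨v, hv, rfl⟩ := List.mem_map.1 hx
  have := deg_add_one_of_mem_rerootList hv
  rw [lpTree_eq_zero (by omega), TensorProduct.tmul_zero]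

theorem rerootSum_anti (a : RTree m) (c : Ctx m) (A B : RTree m) :
    rerootSum n a (c.fill (.node A B)) + rerootSum n a (c.fill (.node B A)) = 0 := by
  induction a generalizing c with
  | leaf i =>
    rw [rerootSum_leaf, rerootSum_leaf, ← TensorProduct.tmul_add, lpTree_anti,
      TensorProduct.tmul_zero]
  | node a b ha hb =>
    rw [rerootSum_node, rerootSum_node, add_add_add_comm]
    have h₁ := ha (.nodeR b c)
    have h₂ := hb (.nodeL c a)
    simp only [Ctx.fill] at h₁ h₂
    rw [h₁, h₂, add_zero]

theorem rerootSum_jac (a : RTree m) (c : Ctx m) (A B C : RTree m) :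
    rerootSum n a (c.fill (.node A (.node B C))) -
      rerootSum n a (c.fill (.node (.node A B) C)) -
      rerootSum n a (c.fill (.node B (.node A C))) = 0 := by
  induction a generalizing c with
  | leaf i =>
    rw [rerootSum_leaf, rerootSum_leaf, rerootSum_leaf, ← TensorProduct.tmul_sub,
      ← TensorProduct.tmul_sub, lpTree_jac, TensorProduct.tmul_zero]
  | node a b ha hb =>
    have h₁ := ha (.nodeR b c)
    have h₂ := hb (.nodeL c a)
    simp only [Ctx.fill] at h₁ h₂
    rw [rerootSum_node, rerootSum_node, rerootSum_node, add_sub_add_comm, add_sub_add_comm, h₁,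
      h₂, add_zero]

theorem bracketLp_rerootSum (a r : RTree m) :
    bracketLp m n (rerootSum n a r) = lpTree (n + 1) (.node a r) := by
  induction a generalizing r with
  | leaf i => rw [rerootSum_leaf, bracketLp_tmul]
  | node a b ha hb =>
    rw [rerootSum_node, map_add, ha, hb]
    have h₁ := lpTree_jac (n := n + 1) .hole a b r
    have h₂ := lpTree_anti (n := n + 1) (.nodeR b .hole) r a
    simp only [Ctx.fill] at h₁ h₂
    rw [eq_neg_of_add_eq_zero_left h₂]
    rw [sub_sub, sub_eq_zero] at h₁
    rw [h₁]
    abel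

variable (n) in
/-- The sum of `X_v ⊗ t_v` over the leaves of the tree `⟨a, b⟩`. -/
noncomputable def pairSum (a b : RTree m) : FreeAbelianGroup (Fin m) ⊗[ℤ] Lp m n :=
  rerootSum n a b + rerootSum n b a

theorem pairSum_eq_sum (a b : RTree m) : pairSum n a b =
    ((pairReroots (a, b)).map fun v => FreeAbelianGroup.of v.1 ⊗ₜ[ℤ] lpTree n v.2).sum := by
  simp [pairSum, rerootSum, pairReroots]

theorem pairSum_eq_zero {a b : RTree m} (h : a.deg + b.deg ≠ n + 1) : pairSum n a b = 0 := by
  rw [pairSum, rerootSum_eq_zero h, rerootSum_eq_zero (by rwa [add_comm]), add_zero]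

variable (m n) in
/-- The subgroup generated by the sums `pairSum`. -/
noncomputable def pairSums : AddSubgroup (FreeAbelianGroup (Fin m) ⊗[ℤ] Lp m n) :=
  AddSubgroup.closure (Set.range fun p : RTree m × RTree m => pairSum n p.1 p.2)

theorem pairSum_mem (a b : RTree m) : pairSum n a b ∈ pairSums m n :=
  AddSubgroup.subset_closure ⟨(a, b), rfl⟩

/-- The value on trees of a section of the bracket modulo the sums `pairSum`. -/
noncomputable def bracketLpSectionTree :
    RTree m → (FreeAbelianGroup (Fin m) ⊗[ℤ] Lp m n) ⧸ pairSums m n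
  | .leaf _ => 0
  | .node a b => QuotientAddGroup.mk' _ (rerootSum n a b)

theorem mk_rerootSum_swap (a b : RTree m) :
    QuotientAddGroup.mk' (pairSums m n) (rerootSum n a b) =
      -QuotientAddGroup.mk' (pairSums m n) (rerootSum n b a) := by
  rw [eq_neg_iff_add_eq_zero, ← map_add]
  exact (QuotientAddGroup.eq_zero_iff _).2 (pairSum_mem a b)

variable (m n) in
/-- A section of the bracket modulo the sums `pairSum`. -/
noncomputable def bracketLpSection :
    Lp m (n + 1) →+ (FreeAbelianGroup (Fin m) ⊗[ℤ] Lp m n) ⧸ pairSums m n :=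
  lpDesc bracketLpSectionTree
    (by
      rintro (i | ⟨a, b⟩) h
      · rfl
      · rw [bracketLpSectionTree, rerootSum_eq_zero h, map_zero])
    (by
      rintro (_ | ⟨c, r⟩ | ⟨l, c⟩) A B <;> simp only [Ctx.fill, bracketLpSectionTree]
      · rw [mk_rerootSum_swap, neg_add_cancel]
      · rw [mk_rerootSum_swap, mk_rerootSum_swap _ r, ← neg_add, ← map_add, rerootSum_anti,
          map_zero, neg_zero]
      · rw [← map_add, rerootSum_anti, map_zero])
    (by
      rintro (_ | ⟨c, r⟩ | ⟨l, c⟩) A B C <;> simp only [Ctx.fill, bracketLpSectionTree]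
      · have := rerootSum_anti (n := n) B .hole A C
        simp only [Ctx.fill] at this
        rw [← map_sub, ← map_sub, rerootSum_node, sub_sub, add_assoc, add_comm (rerootSum n B _),
          this, add_zero, sub_self, map_zero]
      · rw [mk_rerootSum_swap, mk_rerootSum_swap (c.fill (.node (.node A B) C)),
          mk_rerootSum_swap (c.fill (.node B (.node A C))), ← map_neg, ← map_neg, ← map_neg,
          ← map_sub, ← map_sub, ← neg_sub', ← neg_sub', rerootSum_jac, neg_zero, map_zero]
      · rw [← map_sub, ← map_sub, rerootSum_jac, map_zero])

theorem ker_bracketLp_le (z : FreeAbelianGroup (Fin m) ⊗[ℤ] Lp m n) (hz : bracketLp m n z = 0) :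
    z ∈ pairSums m n := by
  have : (bracketLpSection m n).comp (bracketLp m n).toAddMonoidHom =
      QuotientAddGroup.mk' (pairSums m n) := tensor_hom_ext fun i t => by
    refine (congrArg (bracketLpSection m n) (bracketLp_tmul i t)).trans ?_
    rw [bracketLpSection, lpDesc_lpTree, bracketLpSectionTree, rerootSum_leaf]
  have := DFunLike.congr_fun this z
  change bracketLpSection m n (bracketLp m n z) = _ at this
  rw [hz, map_zero] at this
  exact (QuotientAddGroup.eq_zero_iff _).1 this.symm

end Reroot

/-! ### The odd multiple -/

section OddMultiple

variable {m n N : ℕ}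

/-- The gluing map `V ⊗ Lp m N → Tgrp m n`, where `N = n + 1`. -/
noncomputable def glue (hN : N + 1 = n + 2) :
    FreeAbelianGroup (Fin m) ⊗[ℤ] Lp m N →+ Tgrp m n :=
  tensorDesc fun i => lpDesc (tPair n (.leaf i))
    (fun t ht => tPair_eq_zero (by simp only [RTree.deg]; omega)) (tPair_anti _) (tPair_jac _)

theorem glue_rerootSum (hN : N + 1 = n + 2) (a r : RTree m) :
    glue hN (rerootSum N a r) = a.deg • tPair n a r := by
  induction a generalizing r with
  | leaf i => rw [rerootSum_leaf, glue, tensorDesc_tmul, lpDesc_lpTree, RTree.deg, one_smul]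
  | node a b ha hb =>
    rw [rerootSum_node, map_add, ha, hb, RTree.deg, add_smul, ← tPair_slide, ← tPair_slide,
      tPair_symm (.node b r), ← tPair_slide]

theorem glue_pairSum (hN : N + 1 = n + 2) (a b : RTree m) :
    glue hN (pairSum N a b) = (n + 2) • tPair n a b := by
  rw [pairSum, map_add, glue_rerootSum, glue_rerootSum, tPair_symm b, ← add_smul]
  by_cases h : a.deg + b.deg = n + 2
  · rw [h]
  · rw [tPair_eq_zero h, smul_zero, smul_zero]

end OddMultiple

/-! ### Comparison with the invariant form -/

namespace RTree

variable {m : ℕ}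

/-- The underlying labelled binary tree. -/
def toBTree : RTree m → BTree (Fin m)
  | leaf i => .leaf i
  | node a b => .node (toBTree a) (toBTree b)

/-- The rooted tree of a labelled binary tree. -/
def ofBTree : BTree (Fin m) → RTree m
  | .leaf i => leaf i
  | .node a b => node (ofBTree a) (ofBTree b)

theorem ofBTree_toBTree (t : RTree m) : ofBTree t.toBTree = t := by
  induction t with
  | leaf i => rfl
  | node a b ha hb => rw [toBTree, ofBTree, ha, hb]

/-- The class of a rooted tree in the free Lie ring. -/
def toLie (t : RTree m) : FreeLie (Fin m) := .mk t.toBTree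

theorem toLie_leaf (i : Fin m) : (leaf i).toLie = .gen i := rfl

theorem toLie_node (a b : RTree m) : (node a b).toLie = ⁅a.toLie, b.toLie⁆ :=
  FreeLie.mk_node _ _

theorem toLie_anti (c : Ctx m) (A B : RTree m) :
    (c.fill (node A B)).toLie + (c.fill (node B A)).toLie = 0 := by
  induction c with
  | hole => rw [Ctx.fill, Ctx.fill, toLie_node, toLie_node, ← lie_skew, neg_add_cancel]
  | nodeL c r ih => simp only [Ctx.fill, toLie_node, ← add_lie, ih, zero_lie]
  | nodeR l c ih => simp only [Ctx.fill, toLie_node, ← lie_add, ih, lie_zero]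

theorem toLie_jac (c : Ctx m) (A B C : RTree m) :
    (c.fill (node A (node B C))).toLie - (c.fill (node (node A B) C)).toLie -
      (c.fill (node B (node A C))).toLie = 0 := by
  induction c with
  | hole =>
    simp only [Ctx.fill, toLie_node]
    rw [leibniz_lie]; abel
  | nodeL c r ih => simp only [Ctx.fill, toLie_node, ← sub_lie, ih, zero_lie]
  | nodeR l c ih => simp only [Ctx.fill, toLie_node, ← lie_sub, ih, lie_zero]

end RTree

section Comparison

variable {m n N : ℕ}

variable (m N) in
/-- The comparison map from the quasi-Lie ring to the free Lie ring. -/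
noncomputable def lpToLie : Lp m N →+ FreeLie (Fin m) :=
  lpDesc (fun t => cutoff (t.deg = N) t.toLie) (fun t ht => by rw [cutoff, if_neg ht])
    (fun c A B => by
      have h : (c.fill (.node B A)).deg = (c.fill (.node A B)).deg :=
        c.deg_fill_eq (by simp only [RTree.deg]; omega)
      rw [h]
      unfold cutoff
      split_ifs
      · exact RTree.toLie_anti c A B
      · exact add_zero 0)
    (fun c A B C => by
      have h : (c.fill (.node (.node A B) C)).deg = (c.fill (.node A (.node B C))).deg :=
        c.deg_fill_eq (by simp only [RTree.deg]; omega)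
      have h' : (c.fill (.node B (.node A C))).deg = (c.fill (.node A (.node B C))).deg :=
        c.deg_fill_eq (by simp only [RTree.deg]; omega)
      rw [h, h']
      unfold cutoff
      split_ifs
      · exact RTree.toLie_jac c A B C
      · simp)

variable (m N) in
/-- The comparison map on the target of `η'`. -/
noncomputable def toLieV :
    FreeAbelianGroup (Fin m) ⊗[ℤ] Lp m N →+ (Fin m →₀ FreeLie (Fin m)) :=
  tensorDesc fun i => (Finsupp.singleAddHom i).comp (lpToLie m N)

theorem toLieV_rerootSum {a r : RTree m} (h : a.deg + r.deg = N + 1) :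
    toLieV m N (rerootSum N a r) = FreeLie.tens a.toLie r.toLie := by
  induction a generalizing r with
  | leaf i =>
    rw [rerootSum_leaf, toLieV, tensorDesc_tmul, AddMonoidHom.comp_apply, lpToLie, lpDesc_lpTree,
      RTree.toLie_leaf, FreeLie.tens_gen, cutoff, if_pos]
    · rfl
    · simp only [RTree.deg] at h; omega
  | node a b ha hb =>
    simp only [RTree.deg] at h
    rw [rerootSum_node, map_add, ha (by simp only [RTree.deg]; omega),
      hb (by simp only [RTree.deg]; omega), RTree.toLie_node, RTree.toLie_node, RTree.toLie_node,
      FreeLie.tens_lie, ← lie_skew r.toLie, map_neg, sub_eq_add_neg]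

variable (m n) in
/-- The comparison map from the tree group to the universal invariant form. -/
noncomputable def toInvForm : Tgrp m n →+ InvForm (Fin m) :=
  tDesc (fun s t => cutoff (s.deg + t.deg = n + 2) (InvForm.form s.toLie t.toLie))
    (fun s t h => by rw [cutoff, if_neg h])
    (fun s t => by rw [add_comm, InvForm.form_symm, sub_self])
    (fun A B C => by
      simp only [RTree.deg, add_assoc, RTree.toLie_node, InvForm.form_lie, sub_self])
    (fun A B C => by
      simp only [RTree.deg, add_comm B.deg, RTree.toLie_node]
      unfold cutoff
      split_ifs
      · rw [← lie_skew, map_neg, AddMonoidHom.neg_apply, neg_add_cancel]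
      · exact add_zero 0)
    (fun A B C D => by
      simp only [RTree.deg, add_left_comm B.deg, add_assoc, RTree.toLie_node]
      unfold cutoff
      split_ifs
      · rw [leibniz_lie, map_add, AddMonoidHom.add_apply]; abel
      · simp)

theorem toLieV_pairSum (hN : N + 1 = n + 2) (a b : RTree m) :
    toLieV m N (pairSum N a b) = InvForm.eta (toInvForm m n (tPair n a b)) := by
  rw [toInvForm, tDesc_tPair, cutoff]
  split_ifs with h
  · rw [pairSum, map_add, toLieV_rerootSum (by omega), toLieV_rerootSum (by omega),
      InvForm.eta_form]
  · rw [pairSum_eq_zero (by omega), map_zero, map_zero]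

variable (m n) in
/-- Twice the inverse of the comparison map. -/
def ofInvForm : InvForm (Fin m) →+ Tgrp m n :=
  InvForm.desc (fun s t => 2 • tPair n (.ofBTree s) (.ofBTree t)) fun x hx => by
    induction hx with
    | symm a b => simp [tPair_symm (n := n) (.ofBTree a)]
    | slide a b c => simp [RTree.ofBTree, tPair_slide]
    | sq a b => simpa [RTree.ofBTree, two_smul] using tPair_node_anti _ _ _
    | anti a b c => simp [RTree.ofBTree, ← smul_add, tPair_node_anti]
    | jac a b c d => simp [RTree.ofBTree, ← smul_sub, tPair_node_jac]

theorem ofInvForm_toInvForm (x : Tgrp m n) : ofInvForm m n (toInvForm m n x) = 2 • x := by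
  have : (ofInvForm m n).comp (toInvForm m n) = nsmulAddMonoidHom 2 := t_hom_ext fun s t => by
    change ofInvForm m n (toInvForm m n _) = 2 • tPair n s t
    rw [toInvForm, tDesc_tPair, cutoff]
    split_ifs with h
    · rw [RTree.toLie, RTree.toLie, InvForm.form_mk, ofInvForm, InvForm.desc_mk,
        RTree.ofBTree_toBTree, RTree.ofBTree_toBTree]
    · rw [tPair_eq_zero h, smul_zero, map_zero]
  exact DFunLike.congr_fun this x

theorem eq_zero_of_eta_eq_zero (hN : N + 1 = n + 2) (ho : Odd (n + 2))
    {η : Tgrp m n →+ FreeAbelianGroup (Fin m) ⊗[ℤ] Lp m N}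
    (hη : ∀ a b, η (tPair n a b) = pairSum N a b) {x : Tgrp m n} (hx : η x = 0) : x = 0 := by
  have h₁ : (n + 2) • x = 0 := by
    have : (glue hN).comp η = nsmulAddMonoidHom (n + 2) := t_hom_ext fun s t => by
      rw [AddMonoidHom.comp_apply, hη, glue_pairSum]; rfl
    have := DFunLike.congr_fun this x
    rw [AddMonoidHom.comp_apply, hx, map_zero] at this
    exact this.symm
  have h₂ : InvForm.eta (toInvForm m n x) = 0 := by
    have : (toLieV m N).comp η = InvForm.eta.comp (toInvForm m n) := t_hom_ext fun s t => by
      rw [AddMonoidHom.comp_apply, hη, toLieV_pairSum hN]; rfl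
    have := DFunLike.congr_fun this x
    rw [AddMonoidHom.comp_apply, hx, map_zero] at this
    exact this.symm
  obtain ⟨j, hj⟩ := InvForm.exists_pow_two_smul_eq_zero h₂
  have h₃ : 2 ^ (j + 1) • x = 0 := by
    rw [pow_succ, mul_smul, ← ofInvForm_toInvForm, ← map_nsmul, hj, map_zero]
  have hc : Nat.Coprime (n + 2) (2 ^ (j + 1)) := (Nat.coprime_two_right.2 ho).pow_right _
  have hd := Nat.dvd_gcd (addOrderOf_dvd_of_nsmul_eq_zero h₁) (addOrderOf_dvd_of_nsmul_eq_zero h₃)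
  rw [hc, Nat.dvd_one, AddMonoid.addOrderOf_eq_one_iff] at hd
  exact hd

end Comparison

section Squaring

variable {m n : ℕ}

theorem pairSum_mem_ker (a b : RTree m) :
    pairSum n a b ∈ LinearMap.ker (bracketLp m n) := by
  rw [LinearMap.mem_ker, pairSum, map_add, bracketLp_rerootSum, bracketLp_rerootSum]
  exact lpTree_anti .hole a b

theorem pairSum_leaf_node_self (i : Fin m) (J : RTree m) :
    pairSum n (.leaf i) (.node J J) = FreeAbelianGroup.of i ⊗ₜ[ℤ] lpTree n (.node J J) := by
  rw [pairSum, rerootSum_leaf, rerootSum_node]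
  have := rerootSum_anti (n := n) J .hole J (.leaf i)
  simp only [Ctx.fill] at this
  rw [this, add_zero]

theorem eta_eq_pairSum {N : ℕ} (hN : N + 1 = n + 2)
    {η : Tgrp m n →+ FreeAbelianGroup (Fin m) ⊗[ℤ] Lp m N}
    (hη : ∀ p : RTree m × RTree m, p.1.deg + p.2.deg = n + 2 →
      η (TMk m n (FreeAbelianGroup.of p)) =
        ((pairReroots p).map fun v =>
          FreeAbelianGroup.of v.1 ⊗ₜ[ℤ] LpMk m N (FreeAbelianGroup.of v.2)).sum)
    (a b : RTree m) : η (tPair n a b) = pairSum N a b := by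
  by_cases h : a.deg + b.deg = n + 2
  · rw [pairSum_eq_sum]
    exact hη (a, b) h
  · rw [tPair_eq_zero h, pairSum_eq_zero (by omega), map_zero]

theorem eta_twist_eq {M N K n' : ℕ} (hK : K + 1 = n' + 2)
    {σ : Lp m K →+ Lp m N}
    (hσ : ∀ T : RTree m, T.deg = K → σ (lpTree K T) = lpTree N (.node T T))
    {Δ : Tgrp m n' →+ Tgrp m M}
    (hΔ : ∀ p : RTree m × RTree m, p.1.deg + p.2.deg = n' + 2 →
      Δ (TMk m n' (FreeAbelianGroup.of p)) =
        ((pairReroots p).map fun v => tPair M (.leaf v.1) (.node v.2 v.2)).sum)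
    {η : Tgrp m M →+ FreeAbelianGroup (Fin m) ⊗[ℤ] Lp m N}
    (hη : ∀ a b, η (tPair M a b) = pairSum N a b) (a b : RTree m) :
    η (Δ (tPair n' a b)) =
      LinearMap.lTensor (FreeAbelianGroup (Fin m)) σ.toIntLinearMap (pairSum K a b) := by
  by_cases h : a.deg + b.deg = n' + 2
  · refine (congrArg η (hΔ (a, b) h)).trans ?_
    rw [pairSum_eq_sum, map_list_sum, map_list_sum, List.map_map, List.map_map]
    refine congrArg List.sum (List.map_congr_left fun v hv => ?_)
    have hd : v.2.deg = K := by
      rcases List.mem_append.1 hv with hv | hv <;>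
      · have := deg_add_one_of_mem_rerootList hv
        simp only at this
        omega
    change η (tPair M _ _) = FreeAbelianGroup.of v.1 ⊗ₜ[ℤ] σ (lpTree K v.2)
    rw [hη, pairSum_leaf_node_self, hσ _ hd]
  · rw [tPair_eq_zero h, pairSum_eq_zero (by omega), map_zero, map_zero, map_zero]

theorem tGrp_induction {p : Tgrp m n → Prop} (h0 : p 0) (hneg : ∀ x, p x → p (-x))
    (hadd : ∀ x y, p x → p y → p (x + y)) (h : ∀ a b, p (tPair n a b)) (x : Tgrp m n) : p x := by
  obtain ⟨y, rfl⟩ := QuotientAddGroup.mk'_surjective _ x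
  induction y using FreeAbelianGroup.induction_on with
  | zero => exact h0
  | of q => exact h q.1 q.2
  | neg q hq => exact hneg _ hq
  | add y z hy hz => exact hadd _ _ hy hz

theorem mem_range_of_pairSum {A : Type} [AddCommGroup A] {n' : ℕ}
    {f : FreeAbelianGroup (Fin m) ⊗[ℤ] Lp m n →+ A} {g : Tgrp m n' →+ A}
    (h : ∀ a b, g (tPair n' a b) = f (pairSum n a b))
    {z : FreeAbelianGroup (Fin m) ⊗[ℤ] Lp m n} (hz : z ∈ LinearMap.ker (bracketLp m n)) :
    ∃ x, g x = f z := by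
  have hle : pairSums m n ≤ g.range.comap f := (AddSubgroup.closure_le _).2 <| by
    rintro _ ⟨p, rfl⟩
    exact ⟨tPair n' p.1 p.2, h p.1 p.2⟩
  exact hle (ker_bracketLp_le z hz)

end Squaring

/-- For all `m,k ≥ 1`, `η'_{2k-1}` maps the image of `Δ_{2k-1}` into the
image of the homomorphism `ℤ₂ ⊗ D'_{k-1} → D'_{2k-1}` induced by `X ⊗ Y ↦ X ⊗ [Y,Y]`
(i.e. by the squaring map `σ : L'_k → L'_{2k}` on the second tensor factor), and the
induced homomorphism `η̃_{2k-1} : 𝒯̃_{2k-1} → D̃_{2k-1}` is an isomorphism.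
Here `𝒯̃_{2k-1} = 𝒯_{2k-1}/im Δ`, `D'_n = Ker(bracketLp m (n+1))` and
`D̃_{2k-1}` is the quotient of `D'_{2k-1}` by that image. -/
theorem statement10 (m k : ℕ) (hm : 1 ≤ m) (hk : 1 ≤ k)
    (σ : Lp m k →+ Lp m (2 * k))
    (hσ : ∀ T : RTree m, T.deg = k →
      σ (LpMk m k (FreeAbelianGroup.of T)) =
        LpMk m (2 * k) (FreeAbelianGroup.of (RTree.node T T)))
    (Δ : Tgrp m (k - 1) →+ Tgrp m (2 * k - 1))
    (hΔ : ∀ p : RTree m × RTree m, p.1.deg + p.2.deg = (k - 1) + 2 →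
      Δ (TMk m (k - 1) (FreeAbelianGroup.of p)) =
        ((pairReroots p).map fun v =>
          TMk m (2 * k - 1)
            (FreeAbelianGroup.of (RTree.leaf v.1, RTree.node v.2 v.2))).sum)
    (η : Tgrp m (2 * k - 1) →+ (FreeAbelianGroup (Fin m)) ⊗[ℤ] (Lp m (2 * k)))
    (hη : ∀ p : RTree m × RTree m, p.1.deg + p.2.deg = (2 * k - 1) + 2 →
      η (TMk m (2 * k - 1) (FreeAbelianGroup.of p)) =
        ((pairReroots p).map fun v =>
          (FreeAbelianGroup.of v.1) ⊗ₜ[ℤ]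
            (LpMk m (2 * k) (FreeAbelianGroup.of v.2))).sum)
    (hηD : ∀ x : Tgrp m (2 * k - 1), η x ∈ LinearMap.ker (bracketLp m (2 * k))) :
    (∀ x : Tgrp m (k - 1),
      η (Δ x) ∈ Submodule.map
        (LinearMap.lTensor (FreeAbelianGroup (Fin m)) σ.toIntLinearMap)
        (LinearMap.ker (bracketLp m k))) ∧
    ∃ ηt : (Tgrp m (2 * k - 1) ⧸ Δ.range) →+
        (↥(LinearMap.ker (bracketLp m (2 * k))) ⧸
          (Submodule.map
            (LinearMap.lTensor (FreeAbelianGroup (Fin m)) σ.toIntLinearMap)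
            (LinearMap.ker (bracketLp m k))).comap
              (LinearMap.ker (bracketLp m (2 * k))).subtype),
      (∀ x : Tgrp m (2 * k - 1),
        ηt (QuotientAddGroup.mk' Δ.range x) =
          Submodule.Quotient.mk
            (⟨η x, hηD x⟩ : ↥(LinearMap.ker (bracketLp m (2 * k))))) ∧
      Function.Bijective ηt := by
  have hη' : ∀ a b, η (tPair (2 * k - 1) a b) = pairSum (2 * k) a b :=
    eta_eq_pairSum (by omega) hη
  have hηΔ : ∀ a b, η (Δ (tPair (k - 1) a b)) =
      LinearMap.lTensor (FreeAbelianGroup (Fin m)) σ.toIntLinearMap (pairSum k a b) :=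
    eta_twist_eq (by omega) hσ hΔ hη'
  have hmem : ∀ x : Tgrp m (k - 1), η (Δ x) ∈ Submodule.map
      (LinearMap.lTensor (FreeAbelianGroup (Fin m)) σ.toIntLinearMap)
      (LinearMap.ker (bracketLp m k)) := by
    intro x
    induction x using tGrp_induction with
    | h0 => rw [map_zero, map_zero]; exact Submodule.zero_mem _
    | hneg x hx => rw [map_neg, map_neg]; exact Submodule.neg_mem _ hx
    | hadd x y hx hy => rw [map_add, map_add]; exact Submodule.add_mem _ hx hy
    | h a b => exact ⟨_, pairSum_mem_ker a b, (hηΔ a b).symm⟩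
  refine ⟨hmem, ?_⟩
  let ηD : Tgrp m (2 * k - 1) →+ LinearMap.ker (bracketLp m (2 * k)) :=
    { toFun := fun x => ⟨η x, hηD x⟩
      map_zero' := Subtype.ext (map_zero η)
      map_add' := fun x y => Subtype.ext (map_add η x y) }
  let Q := (Submodule.map
    (LinearMap.lTensor (FreeAbelianGroup (Fin m)) σ.toIntLinearMap)
    (LinearMap.ker (bracketLp m k))).comap (LinearMap.ker (bracketLp m (2 * k))).subtype
  refine ⟨QuotientAddGroup.lift Δ.range (Q.mkQ.toAddMonoidHom.comp ηD) ?_, fun x => rfl, ?_, ?_⟩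
  · rintro _ ⟨x, rfl⟩
    exact (Submodule.Quotient.mk_eq_zero Q).2 (hmem x)
  · refine (injective_iff_map_eq_zero _).2 fun x hx => ?_
    obtain ⟨x, rfl⟩ := QuotientAddGroup.mk'_surjective _ x
    obtain ⟨u, hu, hux⟩ := (Submodule.Quotient.mk_eq_zero Q).1 hx
    obtain ⟨w, hw⟩ := mem_range_of_pairSum (g := η.comp Δ)
      (f := (LinearMap.lTensor (FreeAbelianGroup (Fin m)) σ.toIntLinearMap).toAddMonoidHom)
      hηΔ hu
    refine (QuotientAddGroup.eq_zero_iff _).2 ⟨w, ?_⟩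
    refine sub_eq_zero.1 (eq_zero_of_eta_eq_zero (by omega) ⟨k, by omega⟩ hη' ?_)
    rw [map_sub, sub_eq_zero]
    exact hw.trans hux
  · intro y
    obtain ⟨⟨z, hz⟩, rfl⟩ := Submodule.Quotient.mk_surjective Q y
    obtain ⟨x, hx⟩ := mem_range_of_pairSum (g := η) (f := AddMonoidHom.id _) hη' hz
    exact ⟨QuotientAddGroup.mk' _ x, congrArg (Submodule.Quotient.mk (p := Q)) (Subtype.ext hx)⟩
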